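/- arXiv:0708.3257 — 3 statements merged into one kernel-verified Lean document; each statement's English description precedes it below -/
import Mathlib

section
/- Fix an even integer q = 2p with p ≥ 2 and let λ = 2·cos(π/q). For every G_q-irrational number x ∈ [−λ/2, λ/2) there are infinitely many n ≥ 0 with Θ_n(x) ≤ 1/2. The constant 1/2 is best possible: for every c < 1/2 there exists a G_q-irrational x ∈ [−λ/2, λ/2) such that Θ_n(x) > c for all sufficiently large n. -/
noncomputable section

open Real Filter Topology MeasureTheory
open scoped Classical

namespace RosenTong

/-- `λ_q = 2 cos(π/q)`. -/
def lam (q : ℕ) : ℝ := 2 * Real.cos (Real.pi / q)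

/-- The Rosen map `f_q` on `[-λ/2, λ/2)`. -/
def f (l : ℝ) (x : ℝ) : ℝ :=
  if x = 0 then 0 else 1 / |x| - l * (⌊1 / (l * |x|) + 1 / 2⌋ : ℝ)

/-- `x` is `G_q`-irrational: its Rosen orbit never hits `0`. -/
def Irr (l : ℝ) (x : ℝ) : Prop := ∀ n : ℕ, (f l)^[n] x ≠ 0

/-- `ε_n = sign (f^{n-1} x)` (for `n ≥ 1`). -/
def eps (l x : ℝ) (n : ℕ) : ℝ := Real.sign ((f l)^[n - 1] x)

/-- `r_n = ⌊1/(λ |f^{n-1} x|) + 1/2⌋` (for `n ≥ 1`), as a real number. -/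
def rr (l x : ℝ) (n : ℕ) : ℝ := (⌊1 / (l * |(f l)^[n - 1] x|) + 1 / 2⌋ : ℝ)

/-- `((R_{n-1}, R_n), (S_{n-1}, S_n))`. -/
def RS (l x : ℝ) : ℕ → (ℝ × ℝ) × (ℝ × ℝ)
  | 0 => ((1, 0), (0, 1))
  | n + 1 =>
      (((RS l x n).1.2, rr l x (n + 1) * l * (RS l x n).1.2 + eps l x (n + 1) * (RS l x n).1.1),
       ((RS l x n).2.2, rr l x (n + 1) * l * (RS l x n).2.2 + eps l x (n + 1) * (RS l x n).2.1))

/-- Numerator `R_n` of the `n`-th Rosen convergent. -/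
def Rnum (l x : ℝ) (n : ℕ) : ℝ := (RS l x n).1.2

/-- Denominator `S_n` of the `n`-th Rosen convergent. -/
def Snum (l x : ℝ) (n : ℕ) : ℝ := (RS l x n).2.2

/-- The approximation coefficient `Θ_n = S_n² |x - R_n/S_n|`. -/
def theta (l x : ℝ) (n : ℕ) : ℝ := (Snum l x n) ^ 2 * |x - Rnum l x n / Snum l x n|

/-- The natural extension map `𝒯(x,y) = (f x, 1/(r(x)λ + ε(x) y))`. -/
def T (l : ℝ) (z : ℝ × ℝ) : ℝ × ℝ :=
  (f l z.1, 1 / ((⌊1 / (l * |z.1|) + 1 / 2⌋ : ℝ) * l + Real.sign z.1 * z.2))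

/-- `(t_n, v_n) = 𝒯^n (x, 0)`. -/
def tv (l x : ℝ) (n : ℕ) : ℝ × ℝ := (T l)^[n] (x, 0)

/-- `G(y) = -1/(λ + y)`. -/
def G (l : ℝ) (y : ℝ) : ℝ := -1 / (l + y)

/-- `C(y) = -1/(2λ + y)`. -/
def CC (l : ℝ) (y : ℝ) : ℝ := -1 / (2 * l + y)

/-- `τ_k` in the even case `q = 2p`. -/
def tauE (l : ℝ) (p : ℕ) : ℕ → ℝ
  | 0 => -2 / (3 * l)
  | k + 1 => -1 / (2 * l + (G l)^[p - 2] (tauE l p k))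

/-- `τ_k` in the odd case `q = 2h+3`. -/
def tauO (l : ℝ) (h : ℕ) : ℕ → ℝ
  | 0 => -2 / (3 * l)
  | k + 1 => CC l ((G l)^[h] (CC l ((G l)^[h - 1] (tauO l h k))))

/-- `φ_j = f^j(-λ/2)`. -/
def phi (l : ℝ) (j : ℕ) : ℝ := (f l)^[j] (-(l / 2))

/-- The heights `L_j` in the even case: `L_1 = 1/(λ+1)`, `L_j = 1/(λ - L_{j-1})`. -/
def LE (l : ℝ) : ℕ → ℝ
  | 0 => 0
  | 1 => 1 / (l + 1)
  | j + 2 => 1 / (l - LE l (j + 1))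

/-- The natural extension domain `Ω` in the even case `q = 2p`. -/
def OmegaE (l : ℝ) (p : ℕ) : Set (ℝ × ℝ) :=
  (⋃ j ∈ Finset.Icc 1 (p - 1),
    (Set.Ico (phi l (j - 1)) (phi l j)) ×ˢ (Set.Icc 0 (LE l j)))
  ∪ (Set.Ico (0 : ℝ) (l / 2)) ×ˢ (Set.Icc (0 : ℝ) 1)

/-- The region `D` (even case): both `Θ_{n-1}` and `Θ_n` exceed `1/2`. -/
def DE (l : ℝ) (p : ℕ) : Set (ℝ × ℝ) :=
  {z ∈ OmegaE l p | z.2 / (1 + z.1 * z.2) > 1 / 2 ∧ |z.1| / (1 + z.1 * z.2) > 1 / 2}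

/-- The region `A = {(t,v) ∈ D : -2/(3λ) ≤ t ≤ -1/(λ+1)}`. -/
def AE (l : ℝ) (p : ℕ) : Set (ℝ × ℝ) :=
  {z ∈ DE l p | -2 / (3 * l) ≤ z.1 ∧ z.1 ≤ -1 / (l + 1)}

/-- `A_k = {(t,v) ∈ A : t ≥ τ_k}`. -/
def AEk (l : ℝ) (p k : ℕ) : Set (ℝ × ℝ) :=
  {z ∈ AE l p | tauE l p k ≤ z.1}

/-- The invariant measure `ν` (even case), with density `C_q/(1+tv)²` on `Ω`. -/
def nuE (q p : ℕ) : Measure (ℝ × ℝ) :=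
  (volume.restrict (OmegaE (lam q) p)).withDensity fun z =>
    ENNReal.ofReal
      ((1 / Real.log ((1 + Real.cos (Real.pi / q)) / Real.sin (Real.pi / q))) /
        (1 + z.1 * z.2) ^ 2)

/-- The Hurwitz constant `H_q` for odd `q`. -/
def Hodd (l : ℝ) : ℝ := 1 / (2 * Real.sqrt ((1 - l / 2) ^ 2 + 1) )

/-- The positive root `R` of `R² + (2-λ)R - 1 = 0` (odd case). -/
def Rodd (l : ℝ) : ℝ := (l - 2 + Real.sqrt ((2 - l) ^ 2 + 4)) / 2

/-- Two sequences of points organising the Rosen map for `q = 2 (m + 2)`: the orbit `-B j` of the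
left endpoint `-λ/2`, and the heights `L j`, whose negatives form the orbit of `-1 / (λ + 1)`. -/
structure Heights (l : ℝ) (m : ℕ) (L B : ℕ → ℝ) : Prop where
  one_lt : 1 < l
  lt_two : l < 2
  B_zero : B 0 = 0
  B_last : B (m + 1) = l / 2
  B_succ : ∀ j ≤ m, B (j + 1) * (l - B j) = 1
  L_zero : L 0 = -1
  L_last : L (m + 2) = 1
  L_succ : ∀ j ≤ m + 1, L (j + 1) * (l - L j) = 1
  L_mono : ∀ i j, i ≤ j → j ≤ m + 2 → L i ≤ L j

theorem sin_ratio_rec (θ a : ℝ) (h1 : sin (a * θ) ≠ 0) (h2 : sin ((a + 1) * θ) ≠ 0) :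
    sin (a * θ) / sin ((a + 1) * θ) *
      (2 * cos θ - sin ((a - 1) * θ) / sin (a * θ)) = 1 := by
  have e1 : sin ((a + 1) * θ) = sin (a * θ) * cos θ + cos (a * θ) * sin θ := by
    rw [← sin_add]; ring_nf
  have e2 : sin ((a - 1) * θ) = sin (a * θ) * cos θ - cos (a * θ) * sin θ := by
    rw [← sin_sub]; ring_nf
  rw [div_mul_eq_mul_div, div_eq_one_iff_eq h2, mul_sub, mul_div_cancel₀ _ h1, e1, e2]
  ring

theorem sin_ratio_mono (θ a b : ℝ) (hθ : 0 < θ) (hθπ : θ ≤ π) (ha : 0 < a + 1) (hab : a ≤ b)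
    (hb : (b + 1) * θ < π) :
    sin (a * θ) / sin ((a + 1) * θ) ≤ sin (b * θ) / sin ((b + 1) * θ) := by
  have h1 : 0 < sin ((a + 1) * θ) :=
    sin_pos_of_pos_of_lt_pi (by positivity) (by nlinarith)
  have h2 : 0 < sin ((b + 1) * θ) :=
    sin_pos_of_pos_of_lt_pi (by nlinarith) hb
  rw [div_le_div_iff₀ h1 h2]
  have h3 : 0 ≤ sin θ := sin_nonneg_of_nonneg_of_le_pi hθ.le hθπ
  have h4 : 0 ≤ sin (b * θ - a * θ) :=
    sin_nonneg_of_nonneg_of_le_pi (by nlinarith) (by nlinarith)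
  have h5 : sin (b * θ) * sin ((a + 1) * θ) - sin (a * θ) * sin ((b + 1) * θ)
      = sin θ * sin (b * θ - a * θ) := by
    rw [add_mul, add_mul, one_mul, sin_add, sin_add, sin_sub]
    ring
  nlinarith [mul_nonneg h3 h4]

theorem exists_heights (m : ℕ) : ∃ L B : ℕ → ℝ, Heights (lam (2 * (m + 2))) m L B := by
  obtain ⟨θ, hθ⟩ : ∃ θ, θ = π / ((2 * (m + 2) : ℕ) : ℝ) := ⟨_, rfl⟩
  have hm : (0 : ℝ) ≤ m := m.cast_nonneg
  have hπ : 2 * (m + 2) * θ = π := by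
    rw [hθ]; push_cast; field_simp
  have hpos : 0 < θ := by rw [hθ]; positivity
  have hl : lam (2 * (m + 2)) = 2 * cos θ := by rw [hθ]; rfl
  have sp : ∀ a : ℝ, 0 < a → a < 2 * (m + 2) → 0 < sin (a * θ) := fun a h1 h2 =>
    sin_pos_of_pos_of_lt_pi (by positivity) (by rw [← hπ]; nlinarith)
  have hθ4 : θ ≤ π / 4 := by nlinarith
  refine ⟨fun j => sin ((j - 1 / 2) * θ) / sin ((j - 1 / 2 + 1) * θ),
    fun j => sin (j * θ) / sin ((j + 1) * θ), ?_⟩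
  rw [hl]
  constructor
  · have : cos (π / 3) < cos θ :=
      cos_lt_cos_of_nonneg_of_le_pi hpos.le (by linarith [pi_pos]) (by linarith [pi_pos])
    rw [cos_pi_div_three] at this
    linarith
  · have : cos θ < cos 0 :=
      cos_lt_cos_of_nonneg_of_le_pi le_rfl (by linarith [pi_pos]) hpos
    rw [cos_zero] at this
    linarith
  · simp
  · have e1 : ((m + 1 : ℕ) : ℝ) * θ = π / 2 - θ := by push_cast; linarith
    have e2 : (((m + 1 : ℕ) : ℝ) + 1) * θ = π / 2 := by push_cast; linarith
    simp only [e1, e2, sin_pi_div_two, sin_pi_div_two_sub]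
    ring
  · intro j hj
    have hj' : (j : ℝ) ≤ m := by exact_mod_cast hj
    have hj0 : (0 : ℝ) ≤ j := j.cast_nonneg
    have := sin_ratio_rec θ (j + 1) (sp _ (by linarith) (by linarith)).ne'
      (sp _ (by linarith) (by linarith)).ne'
    push_cast
    convert this using 6
    ring
  · have e1 : (((0 : ℕ) : ℝ) - 1 / 2) * θ = -(1 / 2 * θ) := by push_cast; ring
    have e2 : (((0 : ℕ) : ℝ) - 1 / 2 + 1) * θ = 1 / 2 * θ := by push_cast; ring
    simp only [e1, e2, sin_neg]
    rw [neg_div, div_self (sp _ (by norm_num) (by linarith)).ne']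
  · have e1 : (((m + 2 : ℕ) : ℝ) - 1 / 2) * θ = π - (m + 2 + 1 / 2) * θ := by
      rw [← hπ]; push_cast; ring
    have e2 : (((m + 2 : ℕ) : ℝ) - 1 / 2 + 1) * θ = (m + 2 + 1 / 2) * θ := by push_cast; ring
    simp only [e1, e2, sin_pi_sub]
    exact div_self (sp _ (by linarith) (by linarith)).ne'
  · intro j hj
    have hj' : (j : ℝ) ≤ m + 1 := by exact_mod_cast hj
    have hj0 : (0 : ℝ) ≤ j := j.cast_nonneg
    have := sin_ratio_rec θ (j + 1 / 2) (sp _ (by linarith) (by linarith)).ne'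
      (sp _ (by linarith) (by linarith)).ne'
    push_cast
    convert this using 6 <;> ring
  · intro i j hij hj
    have hj' : (j : ℝ) ≤ m + 2 := by exact_mod_cast hj
    have hij' : (i : ℝ) ≤ j := by exact_mod_cast hij
    have hi0 : (0 : ℝ) ≤ i := i.cast_nonneg
    refine sin_ratio_mono θ _ _ hpos (by linarith [pi_pos]) (by linarith) (by linarith) ?_
    rw [← hπ]
    nlinarith

namespace Heights

variable {l : ℝ} {m : ℕ} {L B : ℕ → ℝ}

theorem L_one (H : Heights l m L B) : L 1 = 1 / (l + 1) := by
  have := H.L_succ 0 (by omega)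
  rw [H.L_zero] at this
  have h := H.one_lt
  rw [eq_div_iff (by linarith)]
  linarith

theorem L_top (H : Heights l m L B) : L (m + 1) = l - 1 := by
  have := H.L_succ (m + 1) le_rfl
  rw [H.L_last] at this
  linarith

theorem L_pos (H : Heights l m L B) {j : ℕ} (h1 : 1 ≤ j) (h2 : j ≤ m + 2) : 0 < L j := by
  have h := H.one_lt
  have : 0 < L 1 := by rw [H.L_one]; positivity
  exact this.trans_le (H.L_mono 1 j h1 h2)

theorem L_le (H : Heights l m L B) {j : ℕ} (h2 : j ≤ m + 1) : L j ≤ l - 1 := by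
  rw [← H.L_top]
  exact H.L_mono _ _ h2 (by omega)

theorem one_div_L_succ (H : Heights l m L B) {j : ℕ} (h : j ≤ m + 1) :
    1 / L (j + 1) = l - L j := by
  have := H.L_succ j h
  have h0 := H.L_pos (j := j + 1) (by omega) (by omega)
  rw [div_eq_iff h0.ne']
  linarith

end Heights

/-- The digit of the Rosen expansion at `x`. -/
def digit (l x : ℝ) : ℤ := ⌊1 / (l * |x|) + 1 / 2⌋

theorem f_spec {l x : ℝ} (hl : 0 < l) (hx : x ≠ 0) :
    1 / |x| = digit l x * l + f l x ∧ -(l / 2) ≤ f l x ∧ f l x < l / 2 := by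
  have e : f l x = 1 / |x| - l * digit l x := by simp [f, hx, digit]
  have h1 : (digit l x : ℝ) ≤ 1 / (l * |x|) + 1 / 2 := Int.floor_le _
  have h2 : 1 / (l * |x|) + 1 / 2 < digit l x + 1 := Int.lt_floor_add_one _
  have e3 : l * (1 / (l * |x|)) = 1 / |x| := by
    have : 0 < |x| := abs_pos.2 hx
    field_simp
  refine ⟨by rw [e]; ring, ?_, ?_⟩ <;> rw [e, ← e3] <;> nlinarith

theorem f_eq_of_inv_eq {l x y : ℝ} {r : ℤ} (hl : 0 < l) (hx : x ≠ 0)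
    (h : 1 / |x| = r * l + y) (h1 : -(l / 2) ≤ y) (h2 : y < l / 2) :
    digit l x = r ∧ f l x = y := by
  obtain ⟨s1, s2, s3⟩ := f_spec hl hx
  have hd : digit l x = r := by
    have a : ((digit l x - r : ℤ) : ℝ) * l < 1 * l := by push_cast; linarith
    have b : ((r - digit l x : ℤ) : ℝ) * l < 1 * l := by push_cast; linarith
    have a' : ((digit l x - r : ℤ) : ℝ) < 1 := lt_of_mul_lt_mul_right a hl.le
    have b' : ((r - digit l x : ℤ) : ℝ) < 1 := lt_of_mul_lt_mul_right b hl.le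
    have a'' : digit l x - r < 1 := by exact_mod_cast a'
    have b'' : r - digit l x < 1 := by exact_mod_cast b'
    omega
  refine ⟨hd, ?_⟩
  rw [hd] at s1
  linarith

/-- The natural extension domain of the Rosen map, as a condition on a pair `(t, v)`. -/
structure InDomain (m : ℕ) (L B : ℕ → ℝ) (t v : ℝ) : Prop where
  nonneg : 0 ≤ v
  le_one : v ≤ 1
  le_height : ∀ i k, i + k = m + 1 → 1 ≤ i → B k < -t → v ≤ L i

theorem one_le_digit {l t t' : ℝ} {r : ℤ} (h1 : 1 < l) (h2 : l < 2) (ht : t ≠ 0)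
    (hlo : -(l / 2) ≤ t) (hhi : t < l / 2) (h : 1 / |t| = r * l + t') (hhi' : t' < l / 2) :
    1 ≤ r := by
  have h0 : 0 < |t| := abs_pos.2 ht
  have h3 : |t| < 1 := abs_lt.2 ⟨by linarith, by linarith⟩
  have h4 : 1 < 1 / |t| := by rw [lt_div_iff₀ h0]; linarith
  have : 0 < (r : ℝ) * l := by linarith
  have : 0 < (r : ℝ) := pos_of_mul_pos_left this (by linarith)
  exact_mod_cast this

theorem InDomain.step {l : ℝ} {m : ℕ} {L B : ℕ → ℝ} (H : Heights l m L B) {t t' v : ℝ} {r : ℤ}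
    (ht : t ≠ 0) (hlo : -(l / 2) ≤ t) (hhi : t < l / 2) (h : 1 / |t| = r * l + t')
    (hhi' : t' < l / 2) (hlo' : -(l / 2) ≤ t') (hv : InDomain m L B t v) :
    0 < r * l + Real.sign t * v ∧ InDomain m L B t' (1 / (r * l + Real.sign t * v)) := by
  have h1 := H.one_lt
  have h2 := H.lt_two
  have hr := one_le_digit h1 h2 ht hlo hhi h hhi'
  have hr' : (1 : ℝ) ≤ r := by exact_mod_cast hr
  obtain ⟨v0, v1, vh⟩ := hv
  have key : ∀ d : ℝ, l + 1 ≤ d → 0 < d ∧ InDomain m L B t' (1 / d) := by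
    intro d hd
    have hd0 : 0 < d := by linarith
    have hL : 1 / d ≤ L 1 := by
      rw [H.L_one]; exact one_div_le_one_div_of_le (by linarith) hd
    refine ⟨hd0, by positivity, ?_, fun i k hik hi _ => hL.trans (H.L_mono 1 i hi (by omega))⟩
    rw [div_le_one hd0]; linarith
  rcases lt_or_gt_of_ne ht with hneg | hpos
  · rw [Real.sign_of_neg hneg, neg_one_mul, ← sub_eq_add_neg]
    rw [abs_of_neg hneg] at h
    have vl : v ≤ l - 1 := by
      rw [← H.L_top]
      exact vh (m + 1) 0 (by omega) (by omega) (by rw [H.B_zero]; linarith)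
    rcases hr.eq_or_lt with rfl | hr2
    · push_cast at h ⊢
      rw [one_mul] at h ⊢
      have hd : 1 ≤ l - v := by linarith
      refine ⟨by linarith, by positivity, ?_, ?_⟩
      · rw [div_le_one (by linarith)]; exact hd
      · intro i k hik hi hB
        have hs : -t * (l + t') = 1 := by
          rw [← h]; field_simp
        have hBk := H.B_succ k (by omega)
        have hlB : 0 < l - B k := by linarith
        have hB' : B (k + 1) < -t := by
          by_contra hcon
          push Not at hcon
          have : -t * (l + t') < B (k + 1) * (l - B k) :=
            (mul_lt_mul_of_pos_left (by linarith) (by linarith)).trans_le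
              (mul_le_mul_of_nonneg_right hcon hlB.le)
          linarith
        rcases Nat.lt_or_ge k m with hk | hk
        · have hvi := vh (i - 1) (k + 1) (by omega) (by omega) hB'
          have e := H.one_div_L_succ (j := i - 1) (by omega)
          rw [Nat.sub_add_cancel hi] at e
          have hLi := H.L_pos hi (by omega)
          have := H.L_le (j := i - 1) (by omega)
          rw [div_le_iff₀ (by linarith)]
          rw [div_eq_iff hLi.ne'] at e
          nlinarith
        · have : k = m := by omega
          rw [this, H.B_last] at hB'
          linarith
    · have hr3 : (2 : ℝ) ≤ r := by exact_mod_cast hr2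
      exact key _ (by nlinarith)
  · rw [Real.sign_of_pos hpos, one_mul]
    rw [abs_of_pos hpos] at h
    rcases hr.eq_or_lt with rfl | hr2
    · push_cast at h ⊢
      rw [one_mul] at h ⊢
      refine ⟨by linarith, by positivity, ?_, ?_⟩
      · rw [div_le_one (by linarith)]; linarith
      · intro i k hik hi hB
        have hs : t * (l + t') = 1 := by
          rw [← h]; field_simp
        rcases Nat.lt_or_ge k m with hk | hk
        · have e := H.one_div_L_succ (j := i - 1) (by omega)
          rw [Nat.sub_add_cancel hi] at e
          have hLi := H.L_pos hi (by omega)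
          have hLi' := H.L_pos (j := i - 1) (by omega) (by omega)
          rw [div_eq_iff hLi.ne'] at e
          rw [div_le_iff₀ (by linarith)]
          nlinarith [mul_nonneg hLi.le v0, mul_pos hLi hLi']
        · have : k = m := by omega
          subst this
          have hBk := H.B_succ k le_rfl
          rw [H.B_last] at hBk
          have : t * (l + t') < l / 2 * (l - B k) :=
            (mul_lt_mul_of_pos_left (by linarith) hpos).trans
              (mul_lt_mul_of_pos_right hhi (by linarith))
          linarith
    · have hr3 : (2 : ℝ) ≤ r := by exact_mod_cast hr2
      exact key _ (by nlinarith)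

/-- The ratio `S_{n-1} / S_n` of consecutive denominators. -/
def ratio (l x : ℝ) (n : ℕ) : ℝ := (RS l x n).2.1 / (RS l x n).2.2

section Orbit

variable {l : ℝ} {m : ℕ} {L B : ℕ → ℝ} {x : ℝ}

theorem orbit_mem (hl : 0 < l) (hx : x ∈ Set.Ico (-(l / 2)) (l / 2)) (hirr : Irr l x) (n : ℕ) :
    (f l)^[n] x ∈ Set.Ico (-(l / 2)) (l / 2) := by
  cases n with
  | zero => exact hx
  | succ n =>
    rw [Function.iterate_succ_apply']
    exact (f_spec hl (hirr n)).2

theorem RS_succ_fst (l x : ℝ) (n : ℕ) : (RS l x (n + 1)).1 =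
    ((RS l x n).1.2, digit l ((f l)^[n] x) * l * (RS l x n).1.2
      + Real.sign ((f l)^[n] x) * (RS l x n).1.1) := rfl

theorem RS_succ_snd (l x : ℝ) (n : ℕ) : (RS l x (n + 1)).2 =
    ((RS l x n).2.2, digit l ((f l)^[n] x) * l * (RS l x n).2.2
      + Real.sign ((f l)^[n] x) * (RS l x n).2.1) := rfl

theorem ratio_succ_of_pos {n : ℕ} (hS : 0 < (RS l x n).2.2) :
    ratio l x (n + 1) =
      1 / (digit l ((f l)^[n] x) * l + Real.sign ((f l)^[n] x) * ratio l x n) := by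
  have : digit l ((f l)^[n] x) * l * (RS l x n).2.2
      + Real.sign ((f l)^[n] x) * (RS l x n).2.1 = (RS l x n).2.2 *
      (digit l ((f l)^[n] x) * l + Real.sign ((f l)^[n] x) * ratio l x n) := by
    rw [ratio]; field_simp
  rw [ratio, RS_succ_snd]
  dsimp only
  rw [this, div_mul_eq_div_div, div_self hS.ne']

theorem inDomain_orbit (H : Heights l m L B) (hx : x ∈ Set.Ico (-(l / 2)) (l / 2))
    (hirr : Irr l x) (n : ℕ) :
    0 < (RS l x n).2.2 ∧ InDomain m L B ((f l)^[n] x) (ratio l x n) := by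
  have hl : 0 < l := by linarith [H.one_lt]
  induction n with
  | zero =>
    refine ⟨by simp [RS], by simp [RS, ratio], by simp [RS, ratio], fun i k hik hi _ => ?_⟩
    have := H.L_pos hi (by omega)
    simpa [RS, ratio] using this.le
  | succ n ih =>
    obtain ⟨hS, hD⟩ := ih
    obtain ⟨s1, s2, s3⟩ := f_spec hl (hirr n)
    obtain ⟨o1, o2⟩ := orbit_mem hl hx hirr n
    obtain ⟨hd, hD'⟩ := hD.step H (hirr n) o1 o2 s1 s3 s2
    rw [ratio_succ_of_pos hS, Function.iterate_succ_apply']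
    refine ⟨?_, hD'⟩
    rw [RS_succ_snd]
    have := mul_pos hS hd
    rw [ratio] at this
    field_simp at this
    simpa [mul_comm, mul_left_comm, mul_assoc] using this

theorem ratio_succ (H : Heights l m L B) (hx : x ∈ Set.Ico (-(l / 2)) (l / 2))
    (hirr : Irr l x) (n : ℕ) : ratio l x (n + 1) =
      1 / (digit l ((f l)^[n] x) * l + Real.sign ((f l)^[n] x) * ratio l x n) :=
  ratio_succ_of_pos (inDomain_orbit H hx hirr n).1

theorem sign_mul_abs_self (t : ℝ) : Real.sign t * |t| = t := by
  rcases lt_trichotomy t 0 with h | h | h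
  · rw [Real.sign_of_neg h, abs_of_neg h]; ring
  · simp [h]
  · rw [Real.sign_of_pos h, abs_of_pos h]; ring

theorem abs_sign {t : ℝ} (h : t ≠ 0) : |Real.sign t| = 1 := by
  rcases Real.sign_apply_eq_of_ne_zero t h with h | h <;> simp [h]

theorem abs_det_RS (hirr : Irr l x) (n : ℕ) :
    |(RS l x n).1.1 * (RS l x n).2.2 - (RS l x n).1.2 * (RS l x n).2.1| = 1 := by
  induction n with
  | zero => simp [RS]
  | succ n ih =>
    rw [RS_succ_snd, RS_succ_fst]
    dsimp only
    rw [← ih, ← one_mul |(RS l x n).1.1 * _ - _|, ← abs_sign (hirr n), ← abs_mul, ← abs_neg]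
    congr 1
    ring

theorem RS_mobius (hl : 0 < l) (hirr : Irr l x) (n : ℕ) :
    (RS l x n).1.2 + (RS l x n).1.1 * (f l)^[n] x =
      x * ((RS l x n).2.2 + (RS l x n).2.1 * (f l)^[n] x) := by
  induction n with
  | zero => simp [RS]
  | succ n ih =>
    obtain ⟨s1, -, -⟩ := f_spec hl (hirr n)
    rw [RS_succ_snd, RS_succ_fst, Function.iterate_succ_apply']
    dsimp only
    set t := (f l)^[n] x
    have h0 : 0 < |t| := abs_pos.2 (hirr n)
    have e := sign_mul_abs_self t
    rw [div_eq_iff h0.ne'] at s1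
    rw [← e] at ih
    refine mul_right_cancel₀ h0.ne' ?_
    linear_combination ih - ((RS l x n).1.2 - x * (RS l x n).2.2) * s1

theorem theta_eq (H : Heights l m L B) (hx : x ∈ Set.Ico (-(l / 2)) (l / 2))
    (hirr : Irr l x) (n : ℕ) :
    0 < theta l x n ∧
    1 / theta l x n = 1 / |(f l)^[n] x| + Real.sign ((f l)^[n] x) * ratio l x n := by
  have h2 := H.lt_two
  have hl : 0 < l := by linarith [H.one_lt]
  obtain ⟨hS, hD⟩ := inDomain_orbit H hx hirr n
  obtain ⟨o1, o2⟩ := orbit_mem hl hx hirr n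
  have hM := RS_mobius hl hirr n
  have hdet := abs_det_RS hirr n
  have hv := hD.le_one
  have hv0 := hD.nonneg
  have ht := hirr n
  rw [theta, Snum, Rnum]
  set t := (f l)^[n] x
  have hr : (RS l x n).2.1 = ratio l x n * (RS l x n).2.2 := by
    rw [ratio]; field_simp
  set v := ratio l x n
  set S := (RS l x n).2.2
  rw [hr] at hM hdet
  set R := (RS l x n).1.2
  set R' := (RS l x n).1.1
  have hpos : 0 < 1 + t * v := by nlinarith
  have h0 : 0 < |t| := abs_pos.2 ht
  have e1 : (x * S - R) * (S * (1 + t * v)) = t * (R' * S - R * (v * S)) := by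
    linear_combination (-S) * hM
  have e2 : |x * S - R| * (S * (1 + t * v)) = |t| := by
    have := congrArg abs e1
    rwa [abs_mul, abs_mul t, hdet, mul_one, abs_of_pos (mul_pos hS hpos)] at this
  have e3 : S ^ 2 * |x - R / S| = |t| / (1 + t * v) := by
    have : x - R / S = (x * S - R) / S := by field_simp
    rw [this, abs_div, abs_of_pos hS, eq_div_iff hpos.ne', ← e2]
    field_simp
  rw [e3]
  refine ⟨by positivity, ?_⟩
  have e := sign_mul_abs_self t
  rw [one_div_div, div_add' _ _ _ h0.ne']
  congr 1
  linear_combination (-v) * e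

theorem one_div_theta_succ (H : Heights l m L B) (hx : x ∈ Set.Ico (-(l / 2)) (l / 2))
    (hirr : Irr l x) (n : ℕ) :
    0 < ratio l x (n + 1) ∧
    1 / theta l x n = (f l)^[n + 1] x + 1 / ratio l x (n + 1) := by
  have h2 := H.lt_two
  have hl : 0 < l := by linarith [H.one_lt]
  obtain ⟨hS, hD⟩ := inDomain_orbit H hx hirr n
  obtain ⟨o1, o2⟩ := orbit_mem hl hx hirr n
  obtain ⟨s1, s2, s3⟩ := f_spec hl (hirr n)
  obtain ⟨hd, -⟩ := hD.step H (hirr n) o1 o2 s1 s3 s2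
  rw [(theta_eq H hx hirr n).2, ratio_succ H hx hirr n, Function.iterate_succ_apply']
  refine ⟨by positivity, ?_⟩
  rw [one_div_one_div, s1]
  ring

/-- Two consecutive approximation coefficients above `1/2` force a negative orbit point. -/
theorem orbit_neg (H : Heights l m L B) (hx : x ∈ Set.Ico (-(l / 2)) (l / 2))
    (hirr : Irr l x) {n : ℕ} (h1 : 1 / 2 < theta l x n) (h2 : 1 / 2 < theta l x (n + 1)) :
    (f l)^[n + 1] x < 0 := by
  have hl2 := H.lt_two
  have hl : 0 < l := by linarith [H.one_lt]
  by_contra hcon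
  have ht : 0 < (f l)^[n + 1] x := lt_of_le_of_ne (not_lt.1 hcon) (hirr (n + 1)).symm
  obtain ⟨v0, e1⟩ := one_div_theta_succ H hx hirr n
  obtain ⟨-, e2⟩ := theta_eq H hx hirr (n + 1)
  have v1 := (inDomain_orbit H hx hirr (n + 1)).2.le_one
  have ht1 := (orbit_mem hl hx hirr (n + 1)).2
  have a1 : 1 / theta l x n < 2 := by
    rw [div_lt_iff₀ (by linarith)]; linarith
  have a2 : 1 / theta l x (n + 1) < 2 := by
    rw [div_lt_iff₀ (by linarith)]; linarith
  rw [e1] at a1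
  rw [e2, abs_of_pos ht, Real.sign_of_pos ht, one_mul] at a2
  set t := (f l)^[n + 1] x
  set v := ratio l x (n + 1)
  rw [add_div' _ _ _ v0.ne', div_lt_iff₀ v0] at a1
  rw [div_add' _ _ _ ht.ne', div_lt_iff₀ ht] at a2
  nlinarith [mul_nonneg (show 0 ≤ 1 - t by linarith) (show 0 ≤ 1 - v by linarith)]

/-- Along a negative orbit, the distance above the periodic orbit `-L j` expands. -/
theorem expand_step (H : Heights l m L B) {s s' δ : ℝ} {r : ℤ} (hr : 1 ≤ r)
    (hs : s ≤ l / 2) (hs0 : 0 < s') (hs' : s' ≤ l / 2) (h : 1 / s = r * l - s') (hδ : 0 < δ)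
    (hP : ∃ j, 1 ≤ j ∧ j ≤ m + 1 ∧ L j + δ ≤ s ∧ s ≤ B j) :
    ∃ j, 1 ≤ j ∧ j ≤ m + 1 ∧ L j + 2 / l * δ ≤ s' ∧ s' ≤ B j := by
  obtain ⟨j, j1, j2, hLs, hsB⟩ := hP
  have h1 := H.one_lt
  have h2 := H.lt_two
  have hLj := H.L_pos j1 (by omega)
  have hLj' := H.L_le j2
  have sp : 0 < s := by linarith
  have grow : 2 / l * δ ≤ 1 / L j - 1 / s := by
    have : 1 / L j - 1 / s = (s - L j) / (L j * s) := by field_simp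
    rw [this, div_mul_eq_mul_div, div_le_div_iff₀ (by linarith) (by positivity)]
    have a : L j * s ≤ 1 * (l / 2) := mul_le_mul (by linarith) hs sp.le zero_le_one
    nlinarith [mul_le_mul_of_nonneg_left a hδ.le]
  have gpos : 0 < 2 / l * δ := by positivity
  obtain ⟨i, rfl⟩ : ∃ i, j = i + 1 := ⟨j - 1, by omega⟩
  rw [H.one_div_L_succ (by omega)] at grow
  have hBi := H.B_succ i (by omega)
  have hrl : 1 * l ≤ r * l := mul_le_mul_of_nonneg_right (by exact_mod_cast hr) (by linarith)
  rcases hr.eq_or_lt with rfl | hr2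
  · push_cast at h
    rw [one_mul] at h
    rw [h] at grow
    have hB : s' ≤ B i := by
      have e : s * (l - s') = 1 := by rw [← h]; field_simp
      by_contra hcon
      push Not at hcon
      have : s * (l - s') < B (i + 1) * (l - B i) :=
        (mul_lt_mul_of_pos_left (by linarith) sp).trans_le
          (mul_le_mul_of_nonneg_right hsB (by linarith))
      linarith
    rcases Nat.eq_zero_or_pos i with rfl | hi
    · rw [H.B_zero] at hB
      linarith
    · exact ⟨i, hi, by omega, by linarith, hB⟩
  · have hr3 : (2 : ℝ) ≤ r := by exact_mod_cast hr2
    rcases Nat.eq_zero_or_pos i with rfl | hi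
    · rw [H.L_zero] at grow
      have hr4 : r = 2 := by
        by_contra hne
        have : (3 : ℝ) ≤ r := by exact_mod_cast (show 3 ≤ r by omega)
        nlinarith
      refine ⟨m + 1, by omega, le_rfl, ?_, by rw [H.B_last]; exact hs'⟩
      rw [H.L_top]
      rw [hr4] at h
      push_cast at h
      linarith
    · have := H.L_pos (j := i) hi (by omega)
      nlinarith

theorem infinite_theta_le (H : Heights l m L B) (hx : x ∈ Set.Ico (-(l / 2)) (l / 2))
    (hirr : Irr l x) : {n : ℕ | theta l x n ≤ 1 / 2}.Infinite := by
  have h1 := H.one_lt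
  have h2 := H.lt_two
  have hl : 0 < l := by linarith
  intro hfin
  obtain ⟨N, hN⟩ : ∃ N, ∀ n ≥ N, 1 / 2 < theta l x n := by
    obtain ⟨M, hM⟩ := hfin.bddAbove
    refine ⟨M + 1, fun n hn => ?_⟩
    by_contra hcon
    have := hM (show n ∈ {n : ℕ | theta l x n ≤ 1 / 2} from not_lt.1 hcon)
    omega
  obtain ⟨s, hs⟩ : ∃ s : ℕ → ℝ, ∀ n, s n = -(f l)^[N + 1 + n] x := ⟨_, fun _ => rfl⟩
  obtain ⟨r, hr⟩ : ∃ r : ℕ → ℤ, ∀ n, r n = digit l ((f l)^[N + 1 + n] x) := ⟨_, fun _ => rfl⟩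
  have neg : ∀ n, (f l)^[N + 1 + n] x < 0 := fun n => by
    have := orbit_neg H hx hirr (hN (N + n) (by omega)) (hN (N + n + 1) (by omega))
    rwa [show N + 1 + n = N + n + 1 by omega]
  have spos : ∀ n, 0 < s n := fun n => by rw [hs]; linarith [neg n]
  have sle : ∀ n, s n ≤ l / 2 := fun n => by
    rw [hs]; linarith [(orbit_mem hl hx hirr (N + 1 + n)).1]
  have inv_eq : ∀ n, 1 / s n = r n * l - s (n + 1) ∧ 1 ≤ r n := fun n => by
    obtain ⟨s1, s2, s3⟩ := f_spec hl (hirr (N + 1 + n))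
    obtain ⟨o1, o2⟩ := orbit_mem hl hx hirr (N + 1 + n)
    refine ⟨?_, ?_⟩
    · rw [hs, hs, hr, ← add_assoc, Function.iterate_succ_apply', ← abs_of_neg (neg n), s1]
      ring
    · rw [hr]
      exact one_le_digit h1 h2 (hirr _) o1 o2 s1 s3
  have two : ∃ n, 2 ≤ r n := by
    by_contra hcon
    push Not at hcon
    have r1 : ∀ n, r n = 1 := fun n => by
      have a := hcon n
      have b := (inv_eq n).2
      omega
    have hB : ∀ k i, i + k = m + 1 → s k ≤ B i := by
      intro k
      induction k with
      | zero => rintro i rfl; rw [H.B_last]; exact sle 0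
      | succ k ih =>
        intro i hi
        have hk := ih (i + 1) (by omega)
        have e := (inv_eq k).1
        rw [r1] at e
        push_cast at e
        rw [one_mul, div_eq_iff (spos k).ne'] at e
        have hBi := H.B_succ i (by omega)
        have := sle (k + 1)
        by_contra hlt
        push Not at hlt
        have : s k * (l - s (k + 1)) < B (i + 1) * (l - B i) :=
          (mul_lt_mul_of_pos_left (by linarith) (spos k)).trans_le
            (mul_le_mul_of_nonneg_right hk (by linarith))
        linarith
    have := hB (m + 1) 0 (by omega)
    rw [H.B_zero] at this
    linarith [spos (m + 1)]
  obtain ⟨n, hn⟩ := two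
  have start : l - 1 < s (n + 1) := by
    obtain ⟨θ0, e⟩ := theta_eq H hx hirr (N + 1 + n)
    have hθ : 1 / theta l x (N + 1 + n) < 2 := by
      rw [div_lt_iff₀ θ0]
      linarith [hN (N + 1 + n) (by omega)]
    rw [e, abs_of_neg (neg n), Real.sign_of_neg (neg n), ← hs, (inv_eq n).1] at hθ
    have vl := (inDomain_orbit H hx hirr (N + 1 + n)).2.le_height (m + 1) 0 (by omega) (by omega)
      (by rw [H.B_zero]; linarith [neg n])
    rw [H.L_top] at vl
    have : (2 : ℝ) ≤ r n := by exact_mod_cast hn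
    nlinarith
  set δ := s (n + 1) - (l - 1) with hδ
  have δpos : 0 < δ := by linarith
  have all : ∀ k, ∃ j, 1 ≤ j ∧ j ≤ m + 1 ∧ L j + (2 / l) ^ k * δ ≤ s (n + 1 + k) ∧
      s (n + 1 + k) ≤ B j := by
    intro k
    induction k with
    | zero =>
      refine ⟨m + 1, by omega, le_rfl, ?_, ?_⟩
      · rw [H.L_top, pow_zero, add_zero, hδ]; linarith
      · rw [H.B_last]; exact sle _
    | succ k ih =>
      have := expand_step H (inv_eq (n + 1 + k)).2 (sle _) (spos _) (sle _) (inv_eq (n + 1 + k)).1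
        (by positivity) ih
      rw [pow_succ', mul_assoc]
      exact this
  obtain ⟨k, hk⟩ := pow_unbounded_of_one_lt (1 / δ)
    (show 1 < 2 / l by rw [lt_div_iff₀ hl]; linarith)
  obtain ⟨j, j1, j2, h3, -⟩ := all k
  have := H.L_pos j1 (by omega)
  rw [div_lt_iff₀ δpos] at hk
  linarith [sle (n + 1 + k)]

/-- The Rosen map on the periodic orbit `-L j`. -/
theorem f_neg_L (H : Heights l m L B) {j : ℕ} (hj : j ≤ m) :
    digit l (-L (j + 1)) = (if j = 0 then 2 else 1) ∧
      f l (-L (j + 1)) = -L (if j = 0 then m + 1 else j) := by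
  have h1 := H.one_lt
  have h2 := H.lt_two
  have hL := H.L_pos (j := j + 1) (by omega) (by omega)
  have e := H.one_div_L_succ (j := j) (by omega)
  have ha : |(-L (j + 1))| = L (j + 1) := by rw [abs_neg, abs_of_pos hL]
  refine f_eq_of_inv_eq (by linarith) (by linarith) ?_ ?_ ?_
  · rw [ha, e]
    rcases Nat.eq_zero_or_pos j with rfl | hj0
    · simp only [if_true, H.L_top, H.L_zero]
      push_cast
      ring
    · simp only [hj0.ne', if_false]
      push_cast
      ring
  · have := H.L_le (j := if j = 0 then m + 1 else j) (by split_ifs <;> omega)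
    linarith
  · have := H.L_pos (j := if j = 0 then m + 1 else j) (by split_ifs <;> omega)
      (by split_ifs <;> omega)
    linarith

theorem orbit_neg_L_one (H : Heights l m L B) (n : ℕ) :
    ∃ j ≤ m, (f l)^[n] (-L 1) = -L (j + 1) := by
  induction n with
  | zero => exact ⟨0, by omega, rfl⟩
  | succ n ih =>
    obtain ⟨j, hj, e⟩ := ih
    rw [Function.iterate_succ_apply', e, (f_neg_L H hj).2]
    split_ifs with h
    · exact ⟨m, le_rfl, rfl⟩
    · exact ⟨j - 1, by omega, by rw [Nat.sub_add_cancel (by omega)]⟩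

theorem irr_neg_L_one (H : Heights l m L B) : Irr l (-L 1) := fun n => by
  obtain ⟨j, hj, e⟩ := orbit_neg_L_one H n
  rw [e]
  exact neg_ne_zero.2 (H.L_pos (by omega) (by omega)).ne'

theorem neg_L_one_mem (H : Heights l m L B) : -L 1 ∈ Set.Ico (-(l / 2)) (l / 2) := by
  have h1 := H.one_lt
  have h2 := H.lt_two
  have := H.L_pos (j := 1) le_rfl (by omega)
  have := H.L_le (j := 1) (by omega)
  constructor <;> linarith

theorem orbit_ratio_neg_L_one (H : Heights l m L B) (n : ℕ) :
    ∃ j ≤ m, (f l)^[n] (-L 1) = -L (j + 1) ∧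
      |ratio l (-L 1) n - L (m + 1 - j)| ≤ (l - 1) ^ n := by
  have h1 := H.one_lt
  have h2 := H.lt_two
  induction n with
  | zero =>
    refine ⟨0, by omega, rfl, ?_⟩
    simp only [ratio, RS, Nat.sub_zero, H.L_top, pow_zero]
    rw [abs_le]
    constructor <;> norm_num <;> linarith
  | succ n ih =>
    obtain ⟨j, hj, e, hd⟩ := ih
    have hv' := (inDomain_orbit H (neg_L_one_mem H) (irr_neg_L_one H) (n + 1)).2.le_one
    have hrs := ratio_succ H (neg_L_one_mem H) (irr_neg_L_one H) n
    have hpos := (one_div_theta_succ H (neg_L_one_mem H) (irr_neg_L_one H) n).1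
    have hneg : -L (j + 1) < 0 := neg_lt_zero.2 (H.L_pos (by omega) (by omega))
    rw [e, (f_neg_L H hj).1, Real.sign_of_neg hneg] at hrs
    have key : ∀ (d w : ℝ) (i : ℕ), 1 ≤ i → i ≤ m + 1 → ratio l (-L 1) (n + 1) =
        1 / (d - ratio l (-L 1) n) → 1 / L i = d - w → |ratio l (-L 1) n - w| ≤ (l - 1) ^ n →
        |ratio l (-L 1) (n + 1) - L i| ≤ (l - 1) ^ (n + 1) := by
      intro d w i hi hi' a b c
      have hLi := H.L_pos hi (by omega)
      have hLi' := H.L_le hi'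
      set v := ratio l (-L 1) n
      set v' := ratio l (-L 1) (n + 1)
      have a' : d - v = 1 / v' := by rw [a, one_div_one_div]
      have : v' - L i = (v - w) * (v' * L i) := by
        have : v - w = 1 / L i - 1 / v' := by linarith
        rw [this]
        field_simp
      rw [this, abs_mul, abs_of_pos (mul_pos hpos hLi), pow_succ]
      refine mul_le_mul c ?_ (by positivity) (pow_nonneg (by linarith) n)
      nlinarith
    rw [Function.iterate_succ_apply', e, (f_neg_L H hj).2]
    rcases Nat.eq_zero_or_pos j with rfl | hj0
    · refine ⟨m, le_rfl, by simp, ?_⟩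
      refine key (2 * l) (L (m + 1 - 0)) _ (by omega) (by omega) ?_ ?_ hd
      · rw [hrs]
        simp [sub_eq_add_neg]
      · rw [show m + 1 - m = 0 + 1 by omega, H.one_div_L_succ (by omega), H.L_zero,
          Nat.sub_zero, H.L_top]
        ring
    · refine ⟨j - 1, by omega, ?_, ?_⟩
      · rw [if_neg hj0.ne', Nat.sub_add_cancel hj0]
      · refine key l (L (m + 1 - j)) _ (by omega) (by omega) ?_ ?_ hd
        · rw [hrs, if_neg hj0.ne']
          simp [sub_eq_add_neg]
        · rw [show m + 1 - (j - 1) = (m + 1 - j) + 1 by omega, H.one_div_L_succ (by omega)]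

theorem one_div_theta_neg_L_one_le (H : Heights l m L B) (n : ℕ) :
    1 / theta l (-L 1) n ≤ 2 + (l - 1) ^ n := by
  have h1 := H.one_lt
  have h2 := H.lt_two
  obtain ⟨j, hj, e, hd⟩ := orbit_ratio_neg_L_one H n
  have hL := H.L_pos (j := j + 1) (by omega) (by omega)
  have v0 := (inDomain_orbit H (neg_L_one_mem H) (irr_neg_L_one H) n).2.nonneg
  rw [(theta_eq H (neg_L_one_mem H) (irr_neg_L_one H) n).2, e, abs_neg, abs_of_pos hL,
    Real.sign_of_neg (by linarith), H.one_div_L_succ (by omega)]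
  have hpow : 0 ≤ (l - 1) ^ n := pow_nonneg (by linarith) n
  rcases Nat.eq_zero_or_pos j with rfl | hj0
  · rw [Nat.sub_zero, H.L_top] at hd
    rw [H.L_zero]
    linarith [(abs_le.1 hd).1]
  · have := H.L_pos (j := j) hj0 (by omega)
    linarith

theorem exists_theta_gt (H : Heights l m L B) {c : ℝ} (hc : c < 1 / 2) :
    ∃ N : ℕ, ∀ n ≥ N, theta l (-L 1) n > c := by
  have h1 := H.one_lt
  have h2 := H.lt_two
  have ht : Tendsto (fun n : ℕ => 1 / (2 + (l - 1) ^ n)) atTop (𝓝 (1 / (2 + 0))) :=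
    tendsto_const_nhds.div ((tendsto_pow_atTop_nhds_zero_of_lt_one (by linarith)
      (by linarith)).const_add 2) (by norm_num)
  obtain ⟨N, hN⟩ := eventually_atTop.1 (ht.eventually_const_lt (by rw [add_zero]; exact hc))
  refine ⟨N, fun n hn => (hN n hn).trans_le ?_⟩
  have hθ := (theta_eq H (neg_L_one_mem H) (irr_neg_L_one H) n).1
  exact (one_div_le hθ (by have := pow_nonneg (show 0 ≤ l - 1 by linarith) n; linarith)).1
    (one_div_theta_neg_L_one_le H n)

end Orbit

/-- Borel-type theorem for even `q = 2p`, with best possible constant `1/2`. -/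
theorem borel_even (q p : ℕ) (hp : 2 ≤ p) (hq : q = 2 * p)
    (x : ℝ) (hx : x ∈ Set.Ico (-(lam q / 2)) (lam q / 2)) (hirr : Irr (lam q) x) :
    {n : ℕ | theta (lam q) x n ≤ 1 / 2}.Infinite ∧
    (∀ c : ℝ, c < 1 / 2 →
      ∃ y ∈ Set.Ico (-(lam q / 2)) (lam q / 2), Irr (lam q) y ∧
        ∃ N : ℕ, ∀ n ≥ N, theta (lam q) y n > c) := by
  obtain ⟨m, rfl⟩ : ∃ m, p = m + 2 := ⟨p - 2, by omega⟩
  subst hq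
  obtain ⟨L, B, H⟩ := exists_heights m
  exact ⟨infinite_theta_le H hx hirr, fun c hc =>
    ⟨-L 1, neg_L_one_mem H, irr_neg_L_one H, exists_theta_gt H hc⟩⟩

end RosenTong
end
end

section
/- Fix an odd integer q = 2h+3 with h ≥ 1, let λ = 2·cos(π/q) and H_q = 1/(2·√((1 − λ/2)² + 1)). For every G_q-irrational number x ∈ [−λ/2, λ/2) there are infinitely many n ≥ 0 with Θ_n(x) ≤ H_q. The constant H_q is best possible: for every c < H_q there exists a G_q-irrational x ∈ [−λ/2, λ/2) such that Θ_n(x) > c for all sufficiently large n. -/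
noncomputable section

open Real Filter Topology MeasureTheory
open scoped Classical

namespace RosenTong

/-- The `k`-fold iterate of `y ↦ 1 / (l - y)` at `x`. -/
def ladder (l x : ℝ) : ℕ → ℝ
  | 0 => x
  | k + 1 => 1 / (l - ladder l x k)

lemma ladder_zero (l x : ℝ) : ladder l x 0 = x := rfl

lemma ladder_succ (l x : ℝ) (k : ℕ) : ladder l x (k + 1) = 1 / (l - ladder l x k) := rfl

lemma Rodd_equation (l : ℝ) : Rodd l ^ 2 + (2 - l) * Rodd l - 1 = 0 := by
  have hs := Real.sq_sqrt (show (0 : ℝ) ≤ (2 - l) ^ 2 + 4 by positivity)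
  unfold Rodd
  nlinarith

lemma Rodd_pos (l : ℝ) : 0 < Rodd l := by
  have hs : |2 - l| < √((2 - l) ^ 2 + 4) := by
    rw [← Real.sqrt_sq_eq_abs]
    exact Real.sqrt_lt_sqrt (sq_nonneg _) (by linarith)
  have := le_abs_self (2 - l)
  unfold Rodd
  linarith

lemma Hodd_eq (l : ℝ) : Hodd l = 1 / (2 * Rodd l + 2 - l) := by
  have hs : √((2 - l) ^ 2 + 4) = 2 * √((1 - l / 2) ^ 2 + 1) := by
    rw [show (2 - l) ^ 2 + 4 = 2 ^ 2 * ((1 - l / 2) ^ 2 + 1) by ring,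
      Real.sqrt_mul (by norm_num), Real.sqrt_sq (by norm_num)]
  unfold Hodd Rodd
  rw [hs]
  congr 1
  ring

/-- The arithmetic of `l = λ_q` for `q = 2h + 3` used in the study of the Rosen map. -/
structure OddIndex (l R : ℝ) (h : ℕ) : Prop where
  one_le : 1 ≤ h
  three_halves_le : 3 / 2 ≤ l
  lt_two : l < 2
  half_lt : l / 2 < R
  lt_one : R < 1
  equation : R ^ 2 + (2 - l) * R - 1 = 0
  ladder_lt : ∀ x : ℝ, x < 1 → ∀ k < h, ladder l x k < l
  ladder_zero_top : ladder l 0 h = l - 1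
  ladder_half_top : ladder l (1 / (l + 1)) h = l / 2
  ladder_low_top : ladder l (1 / (2 + R)) h = l - R
  ladder_high_top : ladder l (1 / (l + R)) h = R

section Trigonometry

variable {θ x : ℝ} {h : ℕ}

lemma sin_add_two_mul (θ u : ℝ) :
    sin ((u + 2) * θ) = 2 * cos θ * sin ((u + 1) * θ) - sin (u * θ) := by
  rw [show (u + 2) * θ = (u + 1) * θ + θ by ring, show u * θ = (u + 1) * θ - θ by ring,
    sin_add, sin_sub]
  ring

lemma sin_sub_mul_sin_pos (hθ : 0 < θ) (hθ' : (2 * h + 3) * θ = π) (hx1 : x < 1)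
    {k : ℕ} (hk : k ≤ h) : 0 < sin ((k + 1) * θ) - x * sin (k * θ) := by
  have hk' : (k : ℝ) ≤ h := by exact_mod_cast hk
  have hk0 : (0 : ℝ) ≤ k := Nat.cast_nonneg k
  have hlt : sin (k * θ) < sin ((k + 1) * θ) := by
    apply Real.sin_lt_sin_of_lt_of_le_pi_div_two
    · nlinarith [Real.pi_pos]
    · nlinarith
    · nlinarith
  have h0 : 0 ≤ sin (k * θ) := by
    apply Real.sin_nonneg_of_nonneg_of_le_pi
    · positivity
    · nlinarith
  nlinarith

lemma ladder_eq_div (hθ : 0 < θ) (hθ' : (2 * h + 3) * θ = π) (hx1 : x < 1)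
    (k : ℕ) (hk : k ≤ h) :
    ladder (2 * cos θ) x k = (sin (k * θ) - x * sin ((k - 1) * θ)) /
      (sin ((k + 1) * θ) - x * sin (k * θ)) := by
  induction k with
  | zero =>
    have hs : 0 < sin θ := by
      have := sin_sub_mul_sin_pos hθ hθ' hx1 (Nat.zero_le h)
      simpa using this
    simp only [ladder_zero, Nat.cast_zero, zero_mul, sin_zero, zero_sub, zero_add, neg_mul,
      one_mul, sin_neg, mul_zero, sub_zero]
    field_simp
  | succ k ih =>
    have h1 := sin_sub_mul_sin_pos hθ hθ' hx1 (Nat.le_of_succ_le hk)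
    have h2 := sin_sub_mul_sin_pos hθ hθ' hx1 hk
    rw [ladder_succ, ih (Nat.le_of_succ_le hk)]
    push_cast at h2 ⊢
    have e1 := sin_add_two_mul θ k
    have e2 := sin_add_two_mul θ (k - 1)
    rw [show (k : ℝ) + 1 + 1 = k + 2 by ring] at h2 ⊢
    rw [show (k : ℝ) - 1 + 2 = k + 1 by ring, show (k : ℝ) - 1 + 1 = k by ring] at e2
    rw [show (k : ℝ) + 1 - 1 = k by ring]
    have key : 2 * cos θ - (sin (k * θ) - x * sin ((k - 1) * θ)) /
        (sin ((k + 1) * θ) - x * sin (k * θ)) =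
        (sin ((k + 2) * θ) - x * sin ((k + 1) * θ)) /
        (sin ((k + 1) * θ) - x * sin (k * θ)) := by
      rw [eq_div_iff h1.ne', sub_mul, div_mul_cancel₀ _ h1.ne']
      linear_combination (-1) * e1 + x * e2
    rw [key, one_div_div]

lemma ladder_top (hθ : 0 < θ) (hθ' : (2 * h + 3) * θ = π) (hx1 : x < 1) :
    ladder (2 * cos θ) x h = (2 * cos θ - 1 - x * ((2 * cos θ) ^ 2 - 2 * cos θ - 1)) /
      (1 - x * (2 * cos θ - 1)) := by
  have hs : 0 < sin ((h + 1) * θ) := by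
    apply Real.sin_pos_of_pos_of_lt_pi
    · positivity
    · nlinarith [(Nat.cast_nonneg h : (0 : ℝ) ≤ h)]
  have e1 := sin_add_two_mul θ h
  have e2 := sin_add_two_mul θ (h - 1)
  rw [show (h : ℝ) - 1 + 2 = h + 1 by ring, show (h : ℝ) - 1 + 1 = h by ring] at e2
  have e3 : sin ((h + 2) * θ) = sin ((h + 1) * θ) := by
    rw [← Real.sin_pi_sub]
    congr 1
    linarith
  have e4 : sin (h * θ) = (2 * cos θ - 1) * sin ((h + 1) * θ) := by linarith
  have e5 : sin ((h - 1) * θ) = ((2 * cos θ) ^ 2 - 2 * cos θ - 1) * sin ((h + 1) * θ) := by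
    rw [e4] at e2
    linear_combination e2
  rw [ladder_eq_div hθ hθ' hx1 h le_rfl, e5, e4,
    ← mul_div_mul_right _ (1 - x * (2 * cos θ - 1)) hs.ne']
  congr 1 <;> ring

lemma ladder_lt_of_lt (hθ : 0 < θ) (hθ' : (2 * h + 3) * θ = π) (hx1 : x < 1)
    {k : ℕ} (hk : k < h) : ladder (2 * cos θ) x k < 2 * cos θ := by
  have h1 := sin_sub_mul_sin_pos hθ hθ' hx1 hk.le
  have h2 := sin_sub_mul_sin_pos hθ hθ' hx1 (Nat.succ_le_of_lt hk)
  rw [ladder_eq_div hθ hθ' hx1 k hk.le, div_lt_iff₀ h1]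
  push_cast at h2
  have e1 := sin_add_two_mul θ k
  have e2 := sin_add_two_mul θ (k - 1)
  rw [show (k : ℝ) + 1 + 1 = k + 2 by ring] at h2
  rw [show (k : ℝ) - 1 + 2 = k + 1 by ring, show (k : ℝ) - 1 + 1 = k by ring] at e2
  rw [e1] at h2
  rw [e2] at h2 ⊢
  linarith

end Trigonometry

lemma oddIndex_lam (q h : ℕ) (hh : 1 ≤ h) (hq : q = 2 * h + 3) :
    OddIndex (lam q) (Rodd (lam q)) h := by
  have hqR : (q : ℝ) = 2 * h + 3 := by exact_mod_cast hq
  have hhR : (1 : ℝ) ≤ h := by exact_mod_cast hh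
  have hθ : 0 < π / q := by rw [hqR]; positivity
  have hθ' : (2 * h + 3) * (π / q) = π := by
    rw [hqR]; field_simp
  have hle : π / q ≤ π / 5 := by
    apply div_le_div_of_nonneg_left Real.pi_pos.le (by norm_num)
    rw [hqR]; linarith
  have hl : 3 / 2 ≤ lam q := by
    have h1 : cos (π / 5) ≤ cos (π / q) :=
      Real.cos_le_cos_of_nonneg_of_le_pi hθ.le (by linarith [Real.pi_pos]) hle
    have h2 : (2 : ℝ) ≤ √5 := Real.le_sqrt_of_sq_le (by norm_num)
    rw [Real.cos_pi_div_five] at h1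
    unfold lam
    linarith
  have hl2 : lam q < 2 := by
    have h1 : cos (π / q) < cos 0 :=
      Real.cos_lt_cos_of_nonneg_of_le_pi le_rfl (by linarith [Real.pi_pos]) hθ
    rw [Real.cos_zero] at h1
    unfold lam
    linarith
  have hR := Rodd_equation (lam q)
  have hR0 := Rodd_pos (lam q)
  have top : ∀ x : ℝ, x < 1 → ladder (lam q) x h =
      (lam q - 1 - x * (lam q ^ 2 - lam q - 1)) / (1 - x * (lam q - 1)) :=
    fun x hx1 => ladder_top hθ hθ' hx1
  have hlt : ∀ x : ℝ, x < 1 → ∀ k < h, ladder (lam q) x k < lam q :=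
    fun x hx1 k hk => ladder_lt_of_lt hθ hθ' hx1 hk
  generalize lam q = l at *
  generalize Rodd l = R at *
  have hR1 : R < 1 := by nlinarith
  refine ⟨hh, hl, hl2, by nlinarith, hR1, hR, hlt, ?_, ?_, ?_, ?_⟩
  · rw [top 0 one_pos]; simp
  · have hx1 : 1 / (l + 1) < 1 := by rw [div_lt_one (by linarith)]; linarith
    rw [top _ hx1, div_eq_div_iff _ two_ne_zero]
    · field_simp
      ring
    · have : 1 - 1 / (l + 1) * (l - 1) = 2 / (l + 1) := by field_simp; ring
      rw [this]
      positivity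
  · have hx1 : 1 / (2 + R) < 1 := by rw [div_lt_one (by linarith)]; linarith
    have h2 : 0 < 2 + R - (l - 1) := by linarith
    rw [top _ hx1, div_eq_iff]
    · field_simp
      linear_combination hR
    · have : 1 - 1 / (2 + R) * (l - 1) = (2 + R - (l - 1)) / (2 + R) := by field_simp
      rw [this]
      positivity
  · have hx1 : 1 / (l + R) < 1 := by rw [div_lt_one (by linarith)]; linarith
    have h2 : 0 < l + R - (l - 1) := by linarith
    have h3 : 0 < l + R := by linarith
    rw [top _ hx1, div_eq_iff]
    · field_simp
      linear_combination (-1) * hR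
    · have : 1 - 1 / (l + R) * (l - 1) = (l + R - (l - 1)) / (l + R) := by field_simp
      rw [this]
      positivity

/-- The natural extension domain of the Rosen map: bounds on the height `z.2` that depend on the
position of `z.1`. -/
def Region (l R : ℝ) (h : ℕ) (z : ℝ × ℝ) : Prop :=
  0 ≤ z.2 ∧ z.2 ≤ R ∧
    (∀ i ≤ h, ladder l 0 (h - i) < -z.1 → z.2 ≤ ladder l (1 / (2 + R)) i) ∧
    (∀ i < h, ladder l (1 / (l + 1)) (h - 1 - i) < -z.1 → z.2 ≤ ladder l (1 / (l + R)) i)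

namespace OddIndex

variable {l R : ℝ} {h : ℕ} {x : ℝ}

lemma R_pos (H : OddIndex l R h) : 0 < R := by linarith [H.half_lt, H.three_halves_le]

lemma one_div_R (H : OddIndex l R h) : 1 / R = R + 2 - l := by
  have := H.R_pos
  field_simp
  linarith [H.equation]

lemma lt_ladder_succ (H : OddIndex l R h) (hx : x < 1) {k : ℕ} (hk : k < h) :
    ladder l x k < ladder l x (k + 1) := by
  have h1 := H.ladder_lt x hx k hk
  rw [ladder_succ, lt_div_iff₀ (by linarith)]
  nlinarith [sq_nonneg (ladder l x k - l / 2), H.lt_two, H.three_halves_le]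

lemma ladder_le_ladder (H : OddIndex l R h) (hx : x < 1) {i j : ℕ} (hij : i ≤ j) (hj : j ≤ h) :
    ladder l x i ≤ ladder l x j := by
  induction j, hij using Nat.le_induction with
  | base => exact le_rfl
  | succ j _ ih => exact (ih (by omega)).trans (H.lt_ladder_succ hx (by omega)).le

lemma low_lt_one (H : OddIndex l R h) : 1 / (2 + R) < 1 := by
  have := H.R_pos
  rw [div_lt_one (by linarith)]; linarith

lemma high_lt_one (H : OddIndex l R h) : 1 / (l + R) < 1 := by
  have := H.R_pos
  have := H.three_halves_le
  rw [div_lt_one (by linarith)]; linarith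

lemma half_lt_one (H : OddIndex l R h) : 1 / (l + 1) < 1 := by
  have := H.three_halves_le
  rw [div_lt_one (by linarith)]; linarith

lemma ladder_high_pred (H : OddIndex l R h) : ladder l (1 / (l + R)) (h - 1) = l - 1 / R := by
  have h1 := H.ladder_high_top
  have h2 := H.ladder_lt _ H.high_lt_one (h - 1) (by have := H.one_le; omega)
  have h3 := H.R_pos
  rw [show h = h - 1 + 1 by have := H.one_le; omega, ladder_succ, div_eq_iff (by linarith)] at h1
  have : 1 / R = l - ladder l (1 / (l + R)) (h - 1) := by
    rw [div_eq_iff h3.ne']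
    linarith
  linarith

lemma ladder_half_pred (H : OddIndex l R h) : ladder l (1 / (l + 1)) (h - 1) = l - 2 / l := by
  have h1 := H.ladder_half_top
  have h2 := H.ladder_lt _ H.half_lt_one (h - 1) (by have := H.one_le; omega)
  have h3 := H.three_halves_le
  rw [show h = h - 1 + 1 by have := H.one_le; omega, ladder_succ, div_eq_iff (by linarith)] at h1
  field_simp
  linarith

lemma rosen_step (H : OddIndex l R h) {t : ℝ} (ht : t ∈ Set.Ico (-(l / 2)) (l / 2))
    (ht0 : t ≠ 0) :
    ∃ r : ℤ, 1 ≤ r ∧ ⌊1 / (l * |t|) + 1 / 2⌋ = r ∧ 1 / |t| = r * l + f l t ∧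
      f l t ∈ Set.Ico (-(l / 2)) (l / 2) := by
  have hl := H.three_halves_le
  have hl2 := H.lt_two
  have ha : 0 < |t| := abs_pos.mpr ht0
  have hal : |t| ≤ l / 2 := abs_le.mpr ⟨ht.1, ht.2.le⟩
  have hf : f l t = 1 / |t| - l * (⌊1 / (l * |t|) + 1 / 2⌋ : ℝ) := by rw [f, if_neg ht0]
  have h1 := Int.floor_le (1 / (l * |t|) + 1 / 2)
  have h2 := Int.lt_floor_add_one (1 / (l * |t|) + 1 / 2)
  have h3 : 1 / |t| = l * (1 / (l * |t|)) := by field_simp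
  refine ⟨_, ?_, rfl, by rw [hf]; ring, ?_, ?_⟩
  · rw [Int.le_floor]
    have : 1 / 2 ≤ 1 / (l * |t|) := by
      apply one_div_le_one_div_of_le (by positivity)
      nlinarith
    push_cast
    linarith
  · rw [hf, h3]; nlinarith
  · rw [hf, h3]; nlinarith

lemma f_mem (H : OddIndex l R h) {t : ℝ} (ht : t ∈ Set.Ico (-(l / 2)) (l / 2))
    (ht0 : t ≠ 0) : f l t ∈ Set.Ico (-(l / 2)) (l / 2) :=
  let ⟨_, _, _, _, hr⟩ := H.rosen_step ht ht0
  hr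

lemma region_zero (H : OddIndex l R h) (t : ℝ) : Region l R h (t, 0) := by
  have h0 := H.R_pos
  have h1 := H.three_halves_le
  refine ⟨le_rfl, H.R_pos.le, fun i hi _ => ?_, fun i hi _ => ?_⟩
  · exact le_trans (by rw [ladder_zero]; positivity)
      (H.ladder_le_ladder H.low_lt_one (Nat.zero_le i) hi)
  · exact le_trans (by rw [ladder_zero]; positivity)
      (H.ladder_le_ladder H.high_lt_one (Nat.zero_le i) hi.le)

/-- On the left half of the domain, heights are at most `l - R`. -/
lemma height_le_of_neg (H : OddIndex l R h) {t v : ℝ} (hz : Region l R h (t, v)) (ht : t < 0) :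
    v ≤ l - R := by
  have := hz.2.2.1 h le_rfl (by simpa [ladder_zero] using ht)
  rwa [H.ladder_low_top] at this

lemma height_le_of_lt (H : OddIndex l R h) {t v : ℝ} (hz : Region l R h (t, v))
    (ht : 1 / (l + 1) < -t) : v ≤ l - 1 / R := by
  have := hz.2.2.2 (h - 1) (by have := H.one_le; omega) (by rw [Nat.sub_self]; exact ht)
  rwa [H.ladder_high_pred] at this

lemma one_div_le_ladder_one (H : OddIndex l R h) (hx0 : 0 ≤ x) (hx : x < 1) {i : ℕ} (hi : 1 ≤ i)
    (hih : i ≤ h) : 1 / l ≤ ladder l x i := by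
  refine le_trans ?_ (H.ladder_le_ladder hx hi hih)
  have := H.three_halves_le
  rw [ladder_succ, ladder_zero]
  exact one_div_le_one_div_of_le (by linarith) (by linarith)

lemma one_div_le_R (H : OddIndex l R h) : 1 / l ≤ R := by
  have := H.three_halves_le
  have := H.half_lt
  rw [div_le_iff₀ (by linarith)]
  nlinarith

lemma region_of_pos (H : OddIndex l R h) {t v : ℝ} (ht : t ∈ Set.Ico (-(l / 2)) (l / 2))
    (ht0 : 0 < t) (hz : Region l R h (t, v)) : Region l R h (T l (t, v)) := by
  obtain ⟨r, hr1, hr, hrt, hf⟩ := H.rosen_step ht ht0.ne'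
  have hl := H.three_halves_le
  have hl2 := H.lt_two
  have hR0 := H.R_pos
  have hR1 := H.lt_one
  have hv0 : 0 ≤ v := hz.1
  have hrR : (1 : ℝ) ≤ r := by exact_mod_cast hr1
  have hrl : l ≤ r * l := by nlinarith
  have hT : T l (t, v) = (f l t, 1 / (r * l + v)) := by
    simp only [T, hr, Real.sign_of_pos ht0, one_mul]
  rw [abs_of_pos ht0] at hrt
  have ht2 : t < l / 2 := ht.2
  have hv' : 1 / (r * l + v) ≤ 1 / l := one_div_le_one_div_of_le (by linarith) (by linarith)
  rw [hT]
  have hlow0 : (0 : ℝ) ≤ 1 / (2 + R) := by positivity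
  have hhigh0 : (0 : ℝ) ≤ 1 / (l + R) := by positivity
  refine ⟨by positivity, hv'.trans H.one_div_le_R, fun i hi hlt => ?_, fun i hi hlt => ?_⟩
  · rcases Nat.eq_zero_or_pos i with rfl | hi0
    · rcases hr1.eq_or_lt with rfl | hr2
      · exfalso
        rw [Nat.sub_zero, H.ladder_zero_top] at hlt
        simp only at hlt
        have : 1 / t < 1 := by rw [hrt]; push_cast; linarith
        rw [div_lt_one ht0] at this
        linarith
      · have hr2' : (2 : ℝ) ≤ r := by exact_mod_cast hr2
        rw [ladder_zero]
        apply one_div_le_one_div_of_le (by linarith)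
        nlinarith
    · exact hv'.trans (H.one_div_le_ladder_one hlow0 H.low_lt_one hi0 hi)
  · rcases Nat.eq_zero_or_pos i with rfl | hi0
    · rcases hr1.eq_or_lt with rfl | hr2
      · exfalso
        rw [Nat.sub_zero, H.ladder_half_pred] at hlt
        simp only at hlt
        have : 1 / t < 2 / l := by rw [hrt]; push_cast; linarith
        rw [div_lt_div_iff₀ ht0 (by linarith)] at this
        linarith
      · have hr2' : (2 : ℝ) ≤ r := by exact_mod_cast hr2
        rw [ladder_zero]
        apply one_div_le_one_div_of_le (by linarith)
        nlinarith
    · exact hv'.trans (H.one_div_le_ladder_one hhigh0 H.high_lt_one hi0 hi.le)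

lemma region_of_neg_of_one (H : OddIndex l R h) {v w w' : ℝ} (hw : w ≤ l / 2) (hw0 : 0 < w)
    (hz : Region l R h (-w, v)) (hww' : 1 / w = l - w') (hw' : -(l / 2) < w') :
    Region l R h (-w', 1 / (l - v)) := by
  have hl := H.three_halves_le
  have hl2 := H.lt_two
  have hR0 := H.R_pos
  have hR1 := H.lt_one
  have hvR : v ≤ R := hz.2.1
  have back : ∀ c, c < l → c < w' → 1 / (l - c) < w := by
    intro c hcl hc
    have : w = 1 / (l - w') := by rw [← hww', one_div_one_div]
    have h0 : 0 < 1 / w := by positivity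
    rw [this]
    exact one_div_lt_one_div_of_lt (by linarith) (by linarith)
  have fwd : ∀ u, u < l → v ≤ u → 1 / (l - v) ≤ 1 / (l - u) := fun u hu hvu =>
    one_div_le_one_div_of_le (by linarith) (by linarith)
  have hRinv := H.one_div_R
  have hhalf : 1 / (l + 1) < w := by
    have h0 : 1 / w < 3 / 2 * l := by linarith
    have : 1 / (3 / 2 * l) < w := by
      rw [div_lt_iff₀ hw0] at h0
      rw [div_lt_iff₀ (by linarith)]
      linarith
    refine lt_of_le_of_lt ?_ this
    exact one_div_le_one_div_of_le (by linarith) (by linarith)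
  refine ⟨?_, ?_, fun i hi hlt => ?_, fun i hi hlt => ?_⟩
  · exact one_div_nonneg.mpr (by linarith)
  · have := fwd _ (by have : 0 < 1 / R := by positivity
                      linarith) (H.height_le_of_lt hz (by rwa [neg_neg]))
    simpa using this
  · simp only [neg_neg] at hlt ⊢
    rcases Nat.eq_zero_or_pos i with rfl | hi0
    · rw [Nat.sub_zero, H.ladder_zero_top] at hlt
      have := back _ (by linarith) hlt
      norm_num at this
      linarith
    · obtain ⟨j, rfl⟩ : ∃ j, i = j + 1 := ⟨i - 1, by omega⟩
      have h1 := back _ (H.ladder_lt 0 one_pos _ (by omega)) hlt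
      rw [← ladder_succ, show h - (j + 1) + 1 = h - j by omega] at h1
      rw [ladder_succ]
      exact fwd _ (H.ladder_lt _ H.low_lt_one _ (by omega))
        (hz.2.2.1 j (by omega) (by simpa using h1))
  · simp only [neg_neg] at hlt ⊢
    have h1 := back _ (H.ladder_lt _ H.half_lt_one _ (by omega)) hlt
    rw [← ladder_succ, show h - 1 - i + 1 = h - i by omega] at h1
    rcases Nat.eq_zero_or_pos i with rfl | hi0
    · rw [Nat.sub_zero, H.ladder_half_top] at h1
      linarith
    · obtain ⟨j, rfl⟩ : ∃ j, i = j + 1 := ⟨i - 1, by omega⟩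
      rw [show h - (j + 1) = h - 1 - j by omega] at h1
      rw [ladder_succ]
      exact fwd _ (H.ladder_lt _ H.high_lt_one _ (by omega))
        (hz.2.2.2 j (by omega) (by simpa using h1))

lemma region_of_neg_of_two_le (H : OddIndex l R h) {v w w' : ℝ} {r : ℤ} (hr : 2 ≤ r)
    (hw0 : 0 < w) (hz : Region l R h (-w, v)) (hww' : 1 / w = r * l - w') :
    Region l R h (-w', 1 / (r * l - v)) := by
  have hl := H.three_halves_le
  have hl2 := H.lt_two
  have hR0 := H.R_pos
  have hR1 := H.lt_one
  have hRinv := H.one_div_R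
  have hv := H.height_le_of_neg hz (by linarith)
  have hr2 : (2 : ℝ) ≤ r := by exact_mod_cast hr
  have hrl : 2 * l ≤ r * l := by nlinarith
  have hv' : 1 / (r * l - v) ≤ 1 / (l + R) :=
    one_div_le_one_div_of_le (by linarith) (by linarith)
  have hlow0 : (0 : ℝ) ≤ 1 / (2 + R) := by positivity
  have hvl : 1 / (l + R) ≤ 1 / l := one_div_le_one_div_of_le (by linarith) (by linarith)
  refine ⟨?_, hv'.trans (hvl.trans H.one_div_le_R), fun i hi hlt => ?_, fun i hi _ => ?_⟩
  · exact one_div_nonneg.mpr (by linarith)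
  · rcases Nat.eq_zero_or_pos i with rfl | hi0
    · rw [ladder_zero]
      rcases hr.eq_or_lt with rfl | hr3
      · rw [Nat.sub_zero, H.ladder_zero_top, neg_neg] at hlt
        push_cast at hww' ⊢
        have h1 : 1 / (l + 1) < w := by
          have h0 : 1 / w < l + 1 := by linarith
          rw [div_lt_iff₀ hw0] at h0
          rw [div_lt_iff₀ (by linarith)]
          linarith
        have h2 := H.height_le_of_lt hz (by rwa [neg_neg])
        exact one_div_le_one_div_of_le (by linarith) (by linarith)
      · have hr3' : (3 : ℝ) ≤ r := by exact_mod_cast hr3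
        have : 3 * l ≤ r * l := by nlinarith
        exact one_div_le_one_div_of_le (by linarith) (by linarith)
    · exact hv'.trans (hvl.trans (H.one_div_le_ladder_one hlow0 H.low_lt_one hi0 hi))
  · exact hv'.trans (H.ladder_le_ladder H.high_lt_one (Nat.zero_le i) hi.le)

lemma region_T (H : OddIndex l R h) {z : ℝ × ℝ} (ht : z.1 ∈ Set.Ico (-(l / 2)) (l / 2))
    (ht0 : z.1 ≠ 0) (hz : Region l R h z) : Region l R h (T l z) := by
  obtain ⟨t, v⟩ := z
  rcases ht0.lt_or_gt with hneg | hpos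
  · obtain ⟨r, hr1, hr, hrt, hf⟩ := H.rosen_step ht ht0
    simp only at ht hneg hr hrt hf
    have hT : T l (t, v) = (- -f l t, 1 / (r * l - v)) := by
      simp only [T, hr, Real.sign_of_neg hneg, neg_neg]
      ring_nf
    rw [abs_of_neg hneg] at hrt
    rw [hT]
    rw [← neg_neg t] at hz
    rcases hr1.eq_or_lt with rfl | hr2
    · have := H.region_of_neg_of_one (w' := -f l t) (by linarith [ht.1]) (by linarith) hz
        (by rw [hrt]; push_cast; ring) (by linarith [hf.2])
      simpa using this
    · exact H.region_of_neg_of_two_le hr2 (by linarith) hz (by rw [hrt]; ring)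
  · exact H.region_of_pos ht hpos hz

end OddIndex

/-- The absolute values along a Rosen orbit all of whose points are negative. -/
def NegOrbit (l : ℝ) (w : ℕ → ℝ) : Prop :=
  ∀ n, 0 < w n ∧ w n ≤ l / 2 ∧ ∃ r : ℤ, 1 ≤ r ∧ 1 / w n = r * l - w (n + 1)

namespace OddIndex

variable {l R : ℝ} {h : ℕ} {x y : ℝ} {w : ℕ → ℝ}

lemma digit_one (H : OddIndex l R h) (hw : NegOrbit l w) {n : ℕ} (hn : 1 / w n < l) :
    1 / w n = l - w (n + 1) := by
  obtain ⟨-, -, r, hr1, hr⟩ := hw n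
  obtain ⟨-, hle, -⟩ := hw (n + 1)
  have hl := H.three_halves_le
  have : r = 1 := by
    by_contra hne
    have : (2 : ℝ) ≤ r := by exact_mod_cast (show (2 : ℤ) ≤ r by omega)
    nlinarith
  rw [hr, this]
  simp

lemma digit_two (H : OddIndex l R h) (hw : NegOrbit l w) {n : ℕ} (hn : l ≤ 1 / w n)
    (hn' : 1 / w n < 5 / 2 * l) : 1 / w n = 2 * l - w (n + 1) := by
  obtain ⟨-, -, r, hr1, hr⟩ := hw n
  obtain ⟨hpos, hle, -⟩ := hw (n + 1)
  have hl := H.three_halves_le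
  have h1 : r ≠ 1 := by
    rintro rfl
    push_cast at hr
    linarith
  have h2 : r < 3 := by
    by_contra hge
    have h3 : (3 : ℝ) ≤ r := by exact_mod_cast (show (3 : ℤ) ≤ r by omega)
    nlinarith
  have : r = 2 := by omega
  rw [hr, this]
  simp

lemma sub_le_mul_of_one_div {a c p u v : ℝ} (hp : p < c) (hpu : p ≤ u) (hv0 : 0 < v)
    (hva : v ≤ a) (huv : 1 / v = c - u) (hone : 1 ≤ c - p) :
    v - 1 / (c - p) ≤ a * (u - p) := by
  have h0 : 0 < c - p := by linarith
  have h1 : v * (c - u) = 1 := by rw [← huv]; field_simp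
  have h2 : v - 1 / (c - p) = v * (u - p) * (1 / (c - p)) := by
    field_simp
    linear_combination h1
  have h3 : 1 / (c - p) ≤ 1 := (div_le_one h0).mpr hone
  have h4 : 0 ≤ u - p := by linarith
  have h5 : 0 ≤ v * (u - p) := by positivity
  rw [h2]
  nlinarith

/-- Applying the inverse of `y ↦ 1 / (l - y)` to an orbit lying between two ladders moves it away
from the lower one. -/
lemma climb_down (H : OddIndex l R h) (hw : NegOrbit l w) (hx0 : 0 ≤ x) (hx : x < 1) (hy : y < 1)
    (htop : ladder l x h ≤ 1) {k j n : ℕ} (hkj : k + j ≤ h) (hlow : ladder l x k < w n)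
    (hup : w n ≤ ladder l y (k + j)) :
    x < w (n + k) ∧ w (n + k) ≤ ladder l y j ∧ w n - ladder l x k ≤ w (n + k) - x := by
  have hl2 := H.lt_two
  induction k generalizing n with
  | zero => simpa [ladder_zero] using ⟨hlow, by simpa using hup⟩
  | succ k ih =>
    obtain ⟨hpos, hle, -⟩ := hw n
    have hxl := H.ladder_lt x hx k (by omega)
    have hyl := H.ladder_lt y hy (k + j) (by omega)
    have hxk : 0 ≤ ladder l x k :=
      hx0.trans (H.ladder_le_ladder hx (Nat.zero_le k) (by omega))
    have hxk1 : ladder l x (k + 1) ≤ 1 := (H.ladder_le_ladder hx (by omega) le_rfl).trans htop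
    rw [ladder_succ] at hlow hxk1
    rw [show k + 1 + j = k + j + 1 by omega, ladder_succ] at hup
    have h1 : 1 / w n < l - ladder l x k := by
      rw [div_lt_iff₀ (by linarith)] at hlow
      rw [div_lt_iff₀ hpos]
      linarith
    have h2 : l - ladder l y (k + j) ≤ 1 / w n := by
      rw [le_div_iff₀ (by linarith)] at hup
      rw [le_div_iff₀ hpos]
      linarith
    have hd := H.digit_one hw (h1.trans_le (by linarith))
    have hone : 1 ≤ l - ladder l x k := by
      rwa [div_le_one (by linarith)] at hxk1
    obtain ⟨i1, i2, i3⟩ := ih (n := n + 1) (by omega) (by linarith) (by linarith)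
    rw [show n + 1 + k = n + (k + 1) by omega] at i1 i2 i3
    have hdev := sub_le_mul_of_one_div hxl (by linarith) hpos (show w n ≤ 1 by linarith) hd hone
    refine ⟨i1, i2, ?_⟩
    rw [ladder_succ]
    linarith

lemma neg_step_two (H : OddIndex l R h) (hw : NegOrbit l w) {n : ℕ} {p c : ℝ} (hp : -(l / 2) < p)
    (hp1 : p ≤ 1) (hlow : 1 / (2 * l - p) < w n) (hc : l ≤ c) (hup : w n ≤ 1 / c) :
    p < w (n + 1) ∧ w (n + 1) ≤ 2 * l - c ∧ w n - 1 / (2 * l - p) ≤ l / 2 * (w (n + 1) - p) := by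
  have hl := H.three_halves_le
  obtain ⟨hpos, hle, -⟩ := hw n
  have h1 : 1 / w n < 2 * l - p := by
    rw [div_lt_iff₀ (by linarith)] at hlow
    rw [div_lt_iff₀ hpos]
    linarith
  have h2 : c ≤ 1 / w n := by
    rw [le_div_iff₀ (by linarith)] at hup
    rw [le_div_iff₀ hpos]
    linarith
  have hd := H.digit_two hw (by linarith) (by linarith)
  exact ⟨by linarith, by linarith,
    sub_le_mul_of_one_div (by linarith) (by linarith) hpos hle hd (by linarith)⟩

lemma neg_long_block (H : OddIndex l R h) (hw : NegOrbit l w) {n : ℕ} (hn : l - R < w n) :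
    l - 1 / R < w (n + h + 1) ∧ w (n + h + 1) ≤ l - 1 ∧
      w n - (l - R) ≤ l / 2 * (w (n + h + 1) - (l - 1 / R)) := by
  have hl := H.three_halves_le
  have hl2 := H.lt_two
  have hR0 := H.R_pos
  have hR1 := H.lt_one
  have hR2 := H.half_lt
  have hinv := H.one_div_R
  obtain ⟨h1, h2, h3⟩ := H.climb_down (n := n) (k := h) (j := 0) (x := 1 / (2 + R)) hw
    (by positivity) H.low_lt_one H.half_lt_one
    (by rw [H.ladder_low_top]; linarith) (by omega)
    (by rwa [H.ladder_low_top]) (by rw [add_zero, H.ladder_half_top]; exact (hw n).2.1)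
  rw [H.ladder_low_top] at h3
  rw [ladder_zero] at h2
  have he : 2 + R = 2 * l - (l - 1 / R) := by linarith
  rw [he] at h1 h3
  obtain ⟨h4, h5, h6⟩ := H.neg_step_two hw (by linarith) (by linarith) h1 (by linarith) h2
  exact ⟨h4, by linarith, by linarith⟩

lemma neg_short_block (H : OddIndex l R h) (hw : NegOrbit l w) {n : ℕ} (hn : l - 1 / R < w n)
    (hn' : w n ≤ l - 1) :
    l - R < w (n + h) ∧ w n - (l - 1 / R) ≤ w (n + h) - (l - R) := by
  have hl := H.three_halves_le
  have hl2 := H.lt_two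
  have hR0 := H.R_pos
  have hR1 := H.lt_one
  have hR2 := H.half_lt
  have hinv := H.one_div_R
  have hh := H.one_le
  obtain ⟨h1, h2, h3⟩ := H.climb_down (n := n) (k := h - 1) (j := 1) (x := 1 / (l + R)) (y := 0) hw
    (by positivity) H.high_lt_one one_pos
    (by rw [H.ladder_high_top]; linarith) (by omega)
    (by rwa [H.ladder_high_pred])
    (by rw [show h - 1 + 1 = h by omega, H.ladder_zero_top]; exact hn')
  rw [H.ladder_high_pred] at h3
  rw [ladder_succ, ladder_zero, sub_zero] at h2
  have he : l + R = 2 * l - (l - R) := by ring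
  rw [he] at h1 h3
  obtain ⟨h4, h5, h6⟩ := H.neg_step_two hw (by linarith) (by linarith) h1 le_rfl h2
  rw [show n + (h - 1) + 1 = n + h by omega] at h4 h6
  exact ⟨h4, by nlinarith⟩

lemma neg_le (H : OddIndex l R h) (hw : NegOrbit l w) (n : ℕ) : w n ≤ l - R := by
  by_contra! hn
  have hl := H.three_halves_le
  have hl2 := H.lt_two
  have hgrow : ∀ k : ℕ, l - R < w (n + k * (2 * h + 1)) ∧
      w n - (l - R) ≤ (l / 2) ^ k * (w (n + k * (2 * h + 1)) - (l - R)) := by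
    intro k
    induction k with
    | zero => simpa using hn
    | succ k ih =>
      obtain ⟨h1, h2⟩ := ih
      obtain ⟨h3, h4, h5⟩ := H.neg_long_block hw h1
      obtain ⟨h6, h7⟩ := H.neg_short_block hw h3 h4
      rw [show n + k * (2 * h + 1) + h + 1 + h = n + (k + 1) * (2 * h + 1) by ring] at h6 h7
      refine ⟨h6, h2.trans ?_⟩
      rw [pow_succ, mul_assoc]
      gcongr
      exact h5.trans (by gcongr)
  obtain ⟨k, hk⟩ := exists_pow_lt_of_lt_one (show 0 < w n - (l - R) by linarith)
    (show l / 2 < 1 by linarith)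
  obtain ⟨h1, h2⟩ := hgrow k
  have h3 := (hw (n + k * (2 * h + 1))).2.1
  have h4 : 0 < (l / 2) ^ k := by positivity
  have h5 := H.lt_one
  nlinarith

lemma exists_one_le_one_div (H : OddIndex l R h) (hw : NegOrbit l w) : ∃ n, l ≤ 1 / w n := by
  by_contra! hcon
  have hl := H.three_halves_le
  have hl2 := H.lt_two
  have hpos : 0 < 1 - l ^ 2 / 4 := by nlinarith
  have hdec : ∀ n : ℕ, w n ≤ w 0 - n * (1 - l ^ 2 / 4) := by
    intro n
    induction n with
    | zero => simp
    | succ n ih =>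
      have h1 := H.digit_one hw (hcon n)
      obtain ⟨h2, h3, -⟩ := hw n
      have h4 : w (n + 1) = l - 1 / w n := by linarith
      have h5 : (1 - l ^ 2 / 4) + l - w n ≤ 1 / w n := by
        rw [le_div_iff₀ h2]
        nlinarith [sq_nonneg (w n - l / 2), mul_nonneg hpos.le (show 0 ≤ 1 - w n by linarith)]
      push_cast
      linarith
  obtain ⟨n, hn⟩ := exists_nat_gt (1 / (1 - l ^ 2 / 4))
  rw [div_lt_iff₀ hpos] at hn
  have h1 := hdec n
  have h2 := (hw n).1
  have h3 := (hw 0).2.1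
  linarith

/-- Along a negative orbit with heights `v` obeying the bounds of the natural extension domain,
some approximation coefficient is small. -/
lemma exists_le_one_div_sub (H : OddIndex l R h) (hw : NegOrbit l w) {v : ℕ → ℝ}
    (hv : ∀ n, Region l R h (-w n, v n)) : ∃ n, 2 * R + 2 - l ≤ 1 / w n - v n := by
  by_contra! hcon
  have hl := H.three_halves_le
  have hl2 := H.lt_two
  have hinv := H.one_div_R
  obtain ⟨n, hn⟩ := H.exists_one_le_one_div hw
  obtain ⟨hpos, hle, -⟩ := hw n
  have h1 := hcon n
  have hR := H.lt_one
  have hvn := H.height_le_of_neg (hv n) (by linarith)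
  have hd := H.digit_two hw hn (by linarith)
  have hw' := H.neg_le hw (n + 1)
  have hup : w n ≤ 1 / (l + 1) := by
    by_contra! hlt
    have := H.height_le_of_lt (hv n) (by simpa using hlt)
    linarith
  have hup' : w (n + 1) ≤ l - 1 := by
    rw [le_div_iff₀ (by linarith)] at hup
    have : l + 1 ≤ 1 / w n := by
      rw [le_div_iff₀ hpos]
      linarith
    linarith
  have := H.neg_short_block hw (n := n + 1) (by linarith) hup'
  have := H.neg_le hw (n + 1 + h)
  linarith

end OddIndex

lemma tv_succ (l x : ℝ) (n : ℕ) : tv l x (n + 1) = T l (tv l x n) :=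
  Function.iterate_succ_apply' ..

lemma tv_fst (l x : ℝ) (n : ℕ) : (tv l x n).1 = (f l)^[n] x := by
  induction n with
  | zero => rfl
  | succ n ih => rw [tv_succ, Function.iterate_succ_apply', ← ih, T]

namespace OddIndex

variable {l R : ℝ} {h : ℕ} {x : ℝ}

lemma tv_fst_mem (H : OddIndex l R h) (hx : x ∈ Set.Ico (-(l / 2)) (l / 2)) (hirr : Irr l x)
    (n : ℕ) : (tv l x n).1 ∈ Set.Ico (-(l / 2)) (l / 2) := by
  induction n with
  | zero => exact hx
  | succ n ih =>
    rw [tv_succ]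
    exact H.f_mem ih (by rw [tv_fst]; exact hirr n)

lemma region_tv (H : OddIndex l R h) (hx : x ∈ Set.Ico (-(l / 2)) (l / 2)) (hirr : Irr l x)
    (n : ℕ) : Region l R h (tv l x n) := by
  induction n with
  | zero => exact H.region_zero x
  | succ n ih =>
    rw [tv_succ]
    exact H.region_T (H.tv_fst_mem hx hirr n) (by rw [tv_fst]; exact hirr n) ih

lemma one_add_tv_pos (H : OddIndex l R h) (hx : x ∈ Set.Ico (-(l / 2)) (l / 2))
    (hirr : Irr l x) (n : ℕ) : 0 < 1 + (tv l x n).1 * (tv l x n).2 := by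
  have ht := (H.tv_fst_mem hx hirr n).1
  have hz := H.region_tv hx hirr n
  have := hz.1
  have := hz.2.1
  have := H.lt_one
  have := H.lt_two
  have := H.three_halves_le
  nlinarith

lemma abs_sign_mul_le {t v : ℝ} (hv : 0 ≤ v) : |Real.sign t * v| ≤ v := by
  rcases Real.sign_apply_eq t with h | h | h <;> simp [h, abs_of_nonneg hv, hv]

lemma sign_mul_abs (t : ℝ) : Real.sign t * |t| = t := by
  rcases lt_trichotomy t 0 with h | rfl | h
  · rw [Real.sign_of_neg h, abs_of_neg h]; ring
  · simp
  · rw [Real.sign_of_pos h, abs_of_pos h]; ring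

lemma tv_step (H : OddIndex l R h) (hx : x ∈ Set.Ico (-(l / 2)) (l / 2)) (hirr : Irr l x)
    (n : ℕ) : ∃ r : ℤ, 1 ≤ r ∧ ⌊1 / (l * |(tv l x n).1|) + 1 / 2⌋ = r ∧
      0 < r * l + Real.sign (tv l x n).1 * (tv l x n).2 ∧
      (tv l x (n + 1)).1 = 1 / |(tv l x n).1| - r * l ∧
      (tv l x (n + 1)).2 = 1 / (r * l + Real.sign (tv l x n).1 * (tv l x n).2) := by
  have hz := H.region_tv hx hirr n
  have ht0 : (tv l x n).1 ≠ 0 := by rw [tv_fst]; exact hirr n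
  obtain ⟨r, hr1, hr, hrt, -⟩ := H.rosen_step (H.tv_fst_mem hx hirr n) ht0
  have hR := H.lt_one
  have hl := H.three_halves_le
  have hrR : (1 : ℝ) ≤ r := by exact_mod_cast hr1
  have hv := abs_le.mp (abs_sign_mul_le (t := (tv l x n).1) hz.1)
  have hvR := hz.2.1
  refine ⟨r, hr1, hr, by nlinarith, ?_, ?_⟩
  · rw [tv_succ, T, hrt]; ring
  · rw [tv_succ, T, hr]

lemma convergents (H : OddIndex l R h) (hx : x ∈ Set.Ico (-(l / 2)) (l / 2)) (hirr : Irr l x)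
    (n : ℕ) : 0 < (RS l x n).2.2 ∧ (RS l x n).2.1 = (tv l x n).2 * (RS l x n).2.2 ∧
      x * ((RS l x n).2.2 + (tv l x n).1 * (RS l x n).2.1) =
        (RS l x n).1.2 + (tv l x n).1 * (RS l x n).1.1 ∧
      ((RS l x n).1.1 * (RS l x n).2.2 - (RS l x n).1.2 * (RS l x n).2.1) ^ 2 = 1 := by
  induction n with
  | zero => simp [RS, tv]
  | succ n ih =>
    obtain ⟨h1, h2, h3, h4⟩ := ih
    have ht0 : (tv l x n).1 ≠ 0 := by rw [tv_fst]; exact hirr n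
    obtain ⟨r, -, hr, hD, ht1, hv1⟩ := H.tv_step hx hirr n
    have hεt := sign_mul_abs (tv l x n).1
    have hε2 : Real.sign (tv l x n).1 ^ 2 = 1 := by
      rcases ht0.lt_or_gt with h | h
      · rw [Real.sign_of_neg h]; ring
      · rw [Real.sign_of_pos h]; ring
    have hrr : rr l x (n + 1) = r := by
      rw [rr, Nat.add_sub_cancel, ← tv_fst, hr]
    have hee : eps l x (n + 1) = Real.sign (tv l x n).1 := by
      rw [eps, Nat.add_sub_cancel, ← tv_fst]
    have ha : 0 < |(tv l x n).1| := abs_pos.mpr ht0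
    simp only [RS, hrr, hee, ht1, hv1]
    generalize (tv l x n).1 = t at *
    generalize (tv l x n).2 = v at *
    generalize (RS l x n).1.1 = A at *
    generalize (RS l x n).1.2 = B at *
    generalize (RS l x n).2.1 = C at *
    generalize (RS l x n).2.2 = D at *
    generalize Real.sign t = ε at *
    have hS : r * l * D + ε * C = D * (r * l + ε * v) := by rw [h2]; ring
    refine ⟨by rw [hS]; positivity, by rw [hS]; field_simp, ?_, ?_⟩
    · have key : |t| * (x * (r * l * D + ε * C + (1 / |t| - r * l) * D)) =
          |t| * (r * l * B + ε * A + (1 / |t| - r * l) * B) := by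
        have h5 : |t| * (1 / |t|) = 1 := by field_simp
        linear_combination (D * x - B) * h5 + (C * x - A) * hεt + h3
      exact mul_left_cancel₀ ha.ne' key
    · linear_combination h4 + (A * D - B * C) ^ 2 * hε2

lemma theta_eq (H : OddIndex l R h) (hx : x ∈ Set.Ico (-(l / 2)) (l / 2)) (hirr : Irr l x)
    (n : ℕ) : theta l x n = |(tv l x n).1| / (1 + (tv l x n).1 * (tv l x n).2) := by
  obtain ⟨h1, h2, h3, h4⟩ := H.convergents hx hirr n
  have h6 := H.one_add_tv_pos hx hirr n
  unfold theta Rnum Snum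
  generalize (tv l x n).1 = t at *
  generalize (tv l x n).2 = v at *
  generalize (RS l x n).1.1 = A at *
  generalize (RS l x n).1.2 = B at *
  generalize (RS l x n).2.1 = C at *
  generalize (RS l x n).2.2 = D at *
  have h7 : x - B / D = t * (A * D - B * C) / (D ^ 2 * (1 + t * v)) := by
    rw [eq_div_iff (by positivity), sub_mul, div_mul_eq_mul_div, sub_eq_iff_eq_add,
      ← sub_eq_iff_eq_add', eq_div_iff h1.ne']
    subst h2
    linear_combination D ^ 2 * h3
  have h8 : |A * D - B * C| = 1 := by
    rw [← Real.sqrt_sq_eq_abs, h4, Real.sqrt_one]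
  rw [h7, abs_div, abs_mul t, h8, abs_of_pos (show 0 < D ^ 2 * (1 + t * v) by positivity)]
  field_simp

lemma theta_eq_of_succ (H : OddIndex l R h) (hx : x ∈ Set.Ico (-(l / 2)) (l / 2))
    (hirr : Irr l x) (n : ℕ) :
    theta l x n = (tv l x (n + 1)).2 / (1 + (tv l x (n + 1)).1 * (tv l x (n + 1)).2) := by
  have h6 := H.one_add_tv_pos hx hirr n
  obtain ⟨r, -, -, hD, ht1, hv1⟩ := H.tv_step hx hirr n
  have hεt := sign_mul_abs (tv l x n).1
  have ht0 : (tv l x n).1 ≠ 0 := by rw [tv_fst]; exact hirr n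
  have ha : 0 < |(tv l x n).1| := abs_pos.mpr ht0
  rw [H.theta_eq hx hirr, ht1, hv1]
  generalize (tv l x n).1 = t at *
  generalize (tv l x n).2 = v at *
  generalize Real.sign t = ε at *
  have h7 : 1 + (1 / |t| - r * l) * (1 / (r * l + ε * v)) =
      (1 + t * v) / (|t| * (r * l + ε * v)) := by
    field_simp
    linear_combination v * hεt
  rw [h7]
  generalize r * l + ε * v = D at *
  field_simp

lemma theta_le_of_pos (H : OddIndex l R h) (hx : x ∈ Set.Ico (-(l / 2)) (l / 2))
    (hirr : Irr l x) {n : ℕ} (hpos : 0 < (tv l x (n + 1)).1) :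
    theta l x n ≤ 1 / (2 * R + 2 - l) ∨ theta l x (n + 1) ≤ 1 / (2 * R + 2 - l) := by
  have ht := H.tv_fst_mem hx hirr (n + 1)
  have hz := H.region_tv hx hirr (n + 1)
  have h2 := H.half_lt
  have hR0 := H.R_pos
  have hR1 := H.lt_one
  have hl := H.three_halves_le
  have hl2 := H.lt_two
  rw [H.theta_eq_of_succ hx hirr, H.theta_eq hx hirr, abs_of_pos hpos]
  have hv : 0 ≤ (tv l x (n + 1)).2 := hz.1
  have ht' := ht.2
  generalize (tv l x (n + 1)).1 = t at *
  generalize (tv l x (n + 1)).2 = v at *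
  have hK : 0 < 2 * R + 2 - l := by linarith
  have hden : 0 < 1 + t * v := by positivity
  have key : ∀ s : ℝ, 0 ≤ s → s < R → (2 * R + 2 - l) * s ≤ 1 + s * s := by
    intro s hs0 hs
    have : 0 ≤ (R - s) * (1 - R * s) := mul_nonneg (by linarith) (by nlinarith)
    have h3 := H.equation
    have : 0 ≤ R * (1 + s * s - (2 * R + 2 - l) * s) := by nlinarith
    linarith [(mul_nonneg_iff_of_pos_left hR0).mp this]
  rcases le_total t v with htv | hvt
  · right
    rw [div_le_div_iff₀ hden hK]
    have := key t hpos.le (by linarith)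
    nlinarith
  · left
    rw [div_le_div_iff₀ hden hK]
    have := key v hv (by linarith)
    nlinarith

lemma one_div_div_eq {w v : ℝ} (hw : 0 < w) : w / (1 + -w * v) = 1 / (1 / w - v) := by
  rw [show 1 / w - v = (1 + -w * v) / w by field_simp; ring, one_div_div]

theorem infinite_theta_le (H : OddIndex l R h) (hx : x ∈ Set.Ico (-(l / 2)) (l / 2))
    (hirr : Irr l x) : {n : ℕ | theta l x n ≤ 1 / (2 * R + 2 - l)}.Infinite := by
  intro hfin
  obtain ⟨N, hN⟩ := hfin.bddAbove
  have hgt : ∀ n, N < n → 1 / (2 * R + 2 - l) < theta l x n := by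
    intro n hn
    by_contra! hle
    exact absurd (hN hle) (by omega)
  have hneg : ∀ n, (tv l x (N + 2 + n)).1 < 0 := by
    intro n
    have hne : (tv l x (N + 2 + n)).1 ≠ 0 := by rw [tv_fst]; exact hirr _
    refine lt_of_le_of_ne (not_lt.mp fun hpos => ?_) hne
    rw [show N + 2 + n = N + 1 + n + 1 by ring] at hpos
    rcases H.theta_le_of_pos hx hirr hpos with h1 | h1
    · exact absurd (hgt (N + 1 + n) (by omega)) (not_lt.mpr h1)
    · exact absurd (hgt (N + 1 + n + 1) (by omega)) (not_lt.mpr h1)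
  have hw : NegOrbit l (fun n => -(tv l x (N + 2 + n)).1) := by
    intro n
    have ht := H.tv_fst_mem hx hirr (N + 2 + n)
    obtain ⟨r, hr1, -, hrt, -⟩ := H.rosen_step ht (hneg n).ne
    refine ⟨by linarith [hneg n], by linarith [ht.1], r, hr1, ?_⟩
    rw [abs_of_neg (hneg n)] at hrt
    have h1 : (tv l x (N + 2 + (n + 1))).1 = f l (tv l x (N + 2 + n)).1 := by
      rw [← add_assoc, tv_succ, T]
    simp only [h1, hrt]
    ring
  obtain ⟨n, hn⟩ := H.exists_le_one_div_sub hw (v := fun n => (tv l x (N + 2 + n)).2)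
    (fun n => by simpa using H.region_tv hx hirr (N + 2 + n))
  have h1 := hgt (N + 2 + n) (by omega)
  rw [H.theta_eq hx hirr, abs_of_neg (hneg n)] at h1
  have h2 := one_div_div_eq (w := -(tv l x (N + 2 + n)).1) (v := (tv l x (N + 2 + n)).2)
    (by linarith [hneg n])
  rw [neg_neg] at h2
  rw [h2] at h1
  have hR0 := H.R_pos
  have hl2 := H.lt_two
  exact absurd h1 (not_lt.mpr (one_div_le_one_div_of_le (by linarith) hn))

end OddIndex

/-- The points `(-t, v)` of the periodic orbit of the natural extension map on which the
approximation coefficients are bounded below by the Hurwitz constant. -/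
def Extremal (l R : ℝ) (h : ℕ) (w u : ℝ) : Prop :=
  (∃ i ≤ h, w = ladder l (1 / (2 + R)) (h - i) ∧ u = ladder l (1 / (2 + R)) i) ∨
    ∃ i < h, w = ladder l (1 / (l + R)) (h - 1 - i) ∧ u = ladder l (1 / (l + R)) i

namespace OddIndex

variable {l R : ℝ} {h : ℕ}

lemma extremal_bounds (H : OddIndex l R h) {w u : ℝ} (he : Extremal l R h w u) :
    (0 < w ∧ w ≤ l - R) ∧ 0 < u ∧ u ≤ l - R := by
  have hl := H.three_halves_le
  have hR0 := H.R_pos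
  have hinv := H.one_div_R
  have low : ∀ j ≤ h, 0 < ladder l (1 / (2 + R)) j ∧ ladder l (1 / (2 + R)) j ≤ l - R := by
    intro j hj
    refine ⟨lt_of_lt_of_le ?_ (H.ladder_le_ladder H.low_lt_one (Nat.zero_le j) hj), ?_⟩
    · rw [ladder_zero]; positivity
    · exact (H.ladder_le_ladder H.low_lt_one hj le_rfl).trans H.ladder_low_top.le
  have high : ∀ j < h, 0 < ladder l (1 / (l + R)) j ∧ ladder l (1 / (l + R)) j ≤ l - R := by
    intro j hj
    refine ⟨lt_of_lt_of_le ?_ (H.ladder_le_ladder H.high_lt_one (Nat.zero_le j) hj.le), ?_⟩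
    · rw [ladder_zero]; positivity
    · have h1 := H.ladder_le_ladder H.high_lt_one (show j ≤ h - 1 by omega) (by omega)
      rw [H.ladder_high_pred] at h1
      linarith [H.lt_two]
  rcases he with ⟨i, hi, rfl, rfl⟩ | ⟨i, hi, rfl, rfl⟩
  · exact ⟨low _ (by omega), low _ hi⟩
  · exact ⟨high _ (by omega), high _ hi⟩

lemma extremal_step (H : OddIndex l R h) {w u : ℝ} (he : Extremal l R h w u) :
    1 / w - u ≤ 2 * R + 2 - l ∧
      ∃ (r : ℤ) (w' : ℝ), 1 ≤ r ∧ 1 / w = r * l - w' ∧ Extremal l R h w' (1 / (r * l - u)) := by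
  have hl := H.three_halves_le
  have hl2 := H.lt_two
  have hRh := H.half_lt
  have hinv := H.one_div_R
  have hh := H.one_le
  have hu := (H.extremal_bounds he).2.1
  have one : ∀ w', Extremal l R h w' (1 / (l - u)) → 1 / w = l - w' →
      1 / w - u ≤ 2 * R + 2 - l ∧
      ∃ (r : ℤ) (w' : ℝ), 1 ≤ r ∧ 1 / w = r * l - w' ∧
        Extremal l R h w' (1 / (r * l - u)) := by
    intro w' he' hw
    have := (H.extremal_bounds he').1.1
    exact ⟨by linarith, 1, w', le_rfl, by simpa using hw, by simpa using he'⟩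
  have two : ∀ w', Extremal l R h w' (1 / (2 * l - u)) → 1 / w = 2 * l - w' →
      1 / w - u ≤ 2 * R + 2 - l →
      1 / w - u ≤ 2 * R + 2 - l ∧
      ∃ (r : ℤ) (w' : ℝ), 1 ≤ r ∧ 1 / w = r * l - w' ∧
        Extremal l R h w' (1 / (r * l - u)) := fun w' he' hw hK =>
    ⟨hK, 2, w', by norm_num, by simpa using hw, by simpa using he'⟩
  rcases he with ⟨i, hi, rfl, rfl⟩ | ⟨i, hi, rfl, rfl⟩
  · rcases hi.eq_or_lt with rfl | hi
    · rw [Nat.sub_self, ladder_zero, one_div_one_div, H.ladder_low_top] at *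
      refine two (l - 1 / R) (Or.inr ⟨0, by omega, ?_, ?_⟩) (by linarith) (by linarith)
      · rw [Nat.sub_zero, H.ladder_high_pred]
      · rw [ladder_zero]; ring_nf
    · refine one (ladder l (1 / (2 + R)) (h - (i + 1))) (Or.inl ⟨i + 1, hi, rfl, rfl⟩) ?_
      rw [show h - i = h - (i + 1) + 1 by omega, ladder_succ, one_div_one_div]
  · rcases (show i ≤ h - 1 by omega).eq_or_lt with rfl | hi
    · rw [Nat.sub_self, ladder_zero, one_div_one_div, H.ladder_high_pred] at *
      refine two (l - R) (Or.inl ⟨0, by omega, ?_, ?_⟩) (by linarith) (by linarith)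
      · rw [Nat.sub_zero, H.ladder_low_top]
      · rw [ladder_zero]; congr 1; linarith
    · refine one (ladder l (1 / (l + R)) (h - 1 - (i + 1)))
        (Or.inr ⟨i + 1, by omega, rfl, rfl⟩) ?_
      rw [show h - 1 - i = h - 1 - (i + 1) + 1 by omega, ladder_succ, one_div_one_div]

lemma T_neg (H : OddIndex l R h) {w w' v : ℝ} {r : ℤ} (hw : 0 < w) (hw0 : 0 < w')
    (hw' : w' ≤ l / 2) (hr : 1 / w = r * l - w') : T l (-w, v) = (-w', 1 / (r * l - v)) := by
  have hl := H.three_halves_le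
  have hfl : ⌊1 / (l * w) + 1 / 2⌋ = r := by
    have h1 : 1 / (l * w) = r - w' / l := by
      rw [mul_comm, ← div_div, hr]
      field_simp
    have h2 : w' / l ≤ 1 / 2 := by
      rw [div_le_iff₀ (by linarith)]
      linarith
    have h3 : 0 < w' / l := by positivity
    rw [h1, Int.floor_eq_iff]
    constructor <;> linarith
  have hsign : Real.sign (-w) = -1 := Real.sign_of_neg (by linarith)
  have hf : f l (-w) = -w' := by
    rw [f, if_neg (by linarith), abs_neg, abs_of_pos hw, hfl, hr]
    ring
  simp only [T, hf, abs_neg, abs_of_pos hw, hfl, hsign]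
  ring_nf

lemma extremal_tv (H : OddIndex l R h) (n : ℕ) :
    Region l R h (tv l (-(l - R)) n) ∧
      ∃ w u, Extremal l R h w u ∧ (tv l (-(l - R)) n).1 = -w ∧
        |(tv l (-(l - R)) n).2 - u| ≤ (l / 2) ^ n := by
  have hl := H.three_halves_le
  have hR0 := H.R_pos
  have hR1 := H.lt_one
  have hRh := H.half_lt
  induction n with
  | zero =>
    refine ⟨H.region_zero _, l - R, 1 / (2 + R), Or.inl ⟨0, Nat.zero_le _, ?_, rfl⟩, rfl, ?_⟩
    · rw [Nat.sub_zero, H.ladder_low_top]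
    · rw [show (tv l (-(l - R)) 0).2 = 0 from rfl, zero_sub, abs_neg, pow_zero,
        abs_of_pos (by positivity)]
      exact H.low_lt_one.le
  | succ n ih =>
    obtain ⟨hreg, w, u, he, ht, hv⟩ := ih
    obtain ⟨⟨hw0, hwR⟩, hu0, huR⟩ := H.extremal_bounds he
    obtain ⟨-, r, w', hr1, hr, he'⟩ := H.extremal_step he
    obtain ⟨⟨hw0', hwR'⟩, hu0', huR'⟩ := H.extremal_bounds he'
    rw [tv_succ]
    have hreg' := H.region_T (by rw [ht]; constructor <;> linarith) (by rw [ht]; linarith) hreg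
    refine ⟨hreg', w', _, he', ?_⟩
    generalize tv l (-(l - R)) n = z at *
    obtain ⟨t, v⟩ := z
    simp only at ht hv
    subst ht
    rw [H.T_neg hw0 hw0' (by linarith) hr] at hreg' ⊢
    refine ⟨rfl, ?_⟩
    have hrR : (1 : ℝ) ≤ r := by exact_mod_cast hr1
    have hvR : v ≤ R := hreg.2.1
    have hvR' : 1 / (r * l - v) ≤ R := hreg'.2.1
    have hdv : 0 < r * l - v := by nlinarith
    have hdu : 0 < r * l - u := by nlinarith
    have key : 1 / (r * l - v) - 1 / (r * l - u) =
        (v - u) * (1 / (r * l - v) * (1 / (r * l - u))) := by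
      field_simp
      ring
    have hpos : 0 < 1 / (r * l - v) := by positivity
    simp only
    rw [key, abs_mul, abs_of_pos (mul_pos hpos hu0'), pow_succ]
    exact mul_le_mul hv (by nlinarith) (by positivity) (by positivity)

theorem exists_lt_theta (H : OddIndex l R h) {c : ℝ} (hc : c < 1 / (2 * R + 2 - l)) :
    ∃ y ∈ Set.Ico (-(l / 2)) (l / 2), Irr l y ∧ ∃ N : ℕ, ∀ n ≥ N, theta l y n > c := by
  have hl := H.three_halves_le
  have hl2 := H.lt_two
  have hR0 := H.R_pos
  have hR1 := H.lt_one
  have hRh := H.half_lt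
  have hmem : -(l - R) ∈ Set.Ico (-(l / 2)) (l / 2) := by constructor <;> linarith
  have hirr : Irr l (-(l - R)) := by
    intro n
    obtain ⟨-, w, u, he, ht, -⟩ := H.extremal_tv n
    rw [← tv_fst, ht]
    linarith [(H.extremal_bounds he).1.1]
  have hlim : Tendsto (fun n : ℕ => 1 / (2 * R + 2 - l + (l / 2) ^ n)) atTop
      (𝓝 (1 / (2 * R + 2 - l + 0))) := by
    apply Tendsto.div tendsto_const_nhds _ (by linarith)
    exact tendsto_const_nhds.add
      (tendsto_pow_atTop_nhds_zero_of_lt_one (by linarith) (by linarith))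
  rw [add_zero] at hlim
  obtain ⟨N, hN⟩ := eventually_atTop.mp (hlim.eventually_const_lt hc)
  refine ⟨-(l - R), hmem, hirr, N, fun n hn => (hN n hn).trans_le ?_⟩
  obtain ⟨-, w, u, he, ht, hv⟩ := H.extremal_tv n
  have hw0 := (H.extremal_bounds he).1.1
  have hpos := H.one_add_tv_pos hmem hirr n
  rw [H.theta_eq hmem hirr]
  rw [ht] at hpos ⊢
  rw [abs_neg, abs_of_pos hw0, one_div_div_eq hw0]
  have h1 := (H.extremal_step he).1
  have h2 := (abs_le.mp hv).1
  have h3 : 1 / w - (tv l (-(l - R)) n).2 = (1 + -w * (tv l (-(l - R)) n).2) / w := by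
    field_simp
    ring
  apply one_div_le_one_div_of_le
  · rw [h3]; positivity
  · linarith

end OddIndex

/-- Borel-type theorem for odd `q = 2h+3`, with best possible constant `H_q`. -/
theorem borel_odd (q h : ℕ) (hh : 1 ≤ h) (hq : q = 2 * h + 3)
    (x : ℝ) (hx : x ∈ Set.Ico (-(lam q / 2)) (lam q / 2)) (hirr : Irr (lam q) x) :
    {n : ℕ | theta (lam q) x n ≤ Hodd (lam q)}.Infinite ∧
    (∀ c : ℝ, c < Hodd (lam q) →
      ∃ y ∈ Set.Ico (-(lam q / 2)) (lam q / 2), Irr (lam q) y ∧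
        ∃ N : ℕ, ∀ n ≥ N, theta (lam q) y n > c) := by
  have H := oddIndex_lam q h hh hq
  rw [Hodd_eq]
  exact ⟨H.infinite_theta_le hx hirr, fun _ hc => H.exists_lt_theta hc⟩

end RosenTong
end
end

section
/- Fix an even integer q = 2p with p ≥ 2 and let λ = 2·cos(π/q). For every t ∈ [−2/(3λ), −1/(λ+1)) and every integer k ≥ 1, the following are equivalent: (a) τ_{k−1} ≤ t < τ_k; (b) f_q^{j(p−1)}(t) ∈ [−2/(3λ), −1/(λ+1)) for all 0 ≤ j ≤ k−1, and f_q^{k(p−1)}(t) ∈ [−λ/2, −2/(3λ)). (That is, a point of the region A is flushed after exactly k rounds of p−1 iterations if and only if τ_{k−1} ≤ t < τ_k.) -/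
noncomputable section

open Real Filter Topology MeasureTheory
open scoped Classical

namespace RosenTong

lemma f_eq_of_branch {l x : ℝ} (n : ℤ) (hl : 0 < l) (hx : x < 0)
    (h₁ : (n - 1 / 2) * (l * -x) ≤ 1) (h₂ : 1 < (n + 1 / 2) * (l * -x)) :
    f l x = -1 / x - l * n := by
  have hpos : 0 < l * -x := mul_pos hl (neg_pos.2 hx)
  have hfl : ⌊1 / (l * -x) + 1 / 2⌋ = n := by
    rw [Int.floor_eq_iff]
    constructor
    · have := (le_div_iff₀ hpos).2 h₁
      linarith
    · have := (div_lt_iff₀ hpos).2 h₂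
      linarith
  rw [f, if_neg hx.ne, abs_of_neg hx, hfl]
  congr 1
  rw [div_neg, neg_div]

/-- Sequences with the properties of `n ↦ sin (n π / (2p))` for `λ = 2 cos (π / (2p))`. -/
structure IsSineSeq (l : ℝ) (p : ℕ) (s : ℕ → ℝ) : Prop where
  zero : s 0 = 0
  recurrence : ∀ n, s (n + 2) = l * s (n + 1) - s n
  pos : ∀ n, n + 1 ≤ p → 0 < s (n + 1)
  le : ∀ n, n + 2 ≤ p → s (n + 1) ≤ s (n + 3)
  symm : ∀ n, n + 2 = p → s (n + 1) = s (n + 3)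

lemma isSineSeq_sin {p : ℕ} (hp : 2 ≤ p) :
    IsSineSeq (lam (2 * p)) p (fun n => Real.sin (n * (π / (2 * p : ℕ)))) := by
  have hp0 : (0 : ℝ) < p := by positivity
  have hθ : (p : ℝ) * (π / (2 * p : ℕ)) = π / 2 := by
    push_cast
    field_simp
  set θ := π / (2 * p : ℕ) with hθdef
  have hθ0 : 0 < θ := by positivity
  have hsucc : ∀ n : ℕ, Real.sin ((n + 2 : ℕ) * θ) =
      2 * Real.cos θ * Real.sin ((n + 1 : ℕ) * θ) - Real.sin (n * θ) := by
    intro n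
    have e₁ : ((n + 2 : ℕ) : ℝ) * θ = (n + 1 : ℕ) * θ + θ := by push_cast; ring
    have e₂ : (n : ℝ) * θ = (n + 1 : ℕ) * θ - θ := by push_cast; ring
    rw [e₁, e₂, Real.sin_add, Real.sin_sub]
    ring
  have hdiff : ∀ n : ℕ, Real.sin ((n + 3 : ℕ) * θ) - Real.sin ((n + 1 : ℕ) * θ) =
      2 * Real.cos ((n + 2 : ℕ) * θ) * Real.sin θ := by
    intro n
    have e₁ : ((n + 3 : ℕ) : ℝ) * θ = (n + 2 : ℕ) * θ + θ := by push_cast; ring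
    have e₂ : ((n + 1 : ℕ) : ℝ) * θ = (n + 2 : ℕ) * θ - θ := by push_cast; ring
    rw [e₁, e₂, Real.sin_add, Real.sin_sub]
    ring
  have hbound : ∀ n : ℕ, n ≤ p → (n : ℝ) * θ ≤ π / 2 := by
    intro n hn
    rw [← hθ]
    gcongr
  have hsin : ∀ n : ℕ, n + 1 ≤ p → 0 < Real.sin ((n + 1 : ℕ) * θ) := by
    intro n hn
    have := hbound _ hn
    exact Real.sin_pos_of_pos_of_lt_pi (by positivity) (by linarith [Real.pi_pos])
  refine ⟨by simp, hsucc, hsin, ?_, ?_⟩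
  · intro n hn
    have h₁ := hbound _ hn
    have h₂ : 0 ≤ Real.cos ((n + 2 : ℕ) * θ) :=
      Real.cos_nonneg_of_neg_pi_div_two_le_of_le
        (by have : 0 ≤ ((n + 2 : ℕ) : ℝ) * θ := by positivity
            linarith [Real.pi_pos]) h₁
    have h₃ : 0 < Real.sin θ := by simpa using hsin 0 (by omega)
    have := hdiff n
    have := mul_nonneg h₂ h₃.le
    linarith
  · intro n hn
    have := hdiff n
    rw [hn, hθ, Real.cos_pi_div_two] at this
    linarith

lemma two_le_lam_sq {p : ℕ} (hp : 2 ≤ p) : 2 ≤ lam (2 * p) ^ 2 := by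
  have hp' : (2 : ℝ) ≤ p := by exact_mod_cast hp
  have h : √2 / 2 ≤ Real.cos (π / (2 * p : ℕ)) := by
    rw [← Real.cos_pi_div_four]
    apply Real.cos_le_cos_of_nonneg_of_le_pi (by positivity) (by linarith [Real.pi_pos])
    push_cast
    exact div_le_div_of_nonneg_left Real.pi_pos.le (by norm_num) (by linarith)
  have h₂ : √2 ^ 2 = (2 : ℝ) := Real.sq_sqrt (by norm_num)
  have h₀ := Real.sqrt_nonneg (2 : ℝ)
  unfold lam
  nlinarith

lemma lam_pos {p : ℕ} (hp : 2 ≤ p) : 0 < lam (2 * p) := by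
  have hp' : (2 : ℝ) ≤ p := by exact_mod_cast hp
  have h : π / (2 * p : ℕ) < π / 2 := by
    push_cast
    exact div_lt_div_of_pos_left Real.pi_pos (by norm_num) (by linarith)
  have h₀ : 0 < π / (2 * p : ℕ) := by positivity
  have := Real.cos_pos_of_mem_Ioo ⟨by linarith [Real.pi_pos], h⟩
  unfold lam
  linarith

lemma lam_lt_two {p : ℕ} (hp : 2 ≤ p) : lam (2 * p) < 2 := by
  have hp' : (2 : ℝ) ≤ p := by exact_mod_cast hp
  have h : π / (2 * p : ℕ) ≤ π := by
    push_cast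
    exact div_le_self Real.pi_pos.le (by linarith)
  have h₀ : 0 < π / (2 * p : ℕ) := by positivity
  have := Real.cos_lt_cos_of_nonneg_of_le_pi le_rfl h h₀
  rw [Real.cos_zero] at this
  unfold lam
  linarith

/-- The interval `G^i [-1/λ, -1/(λ+1))`. -/
def cell (s : ℕ → ℝ) (i : ℕ) : Set ℝ :=
  {x | -s (i + 1) ≤ x * s (i + 2) ∧ x * (s (i + 1) + s (i + 2)) < -(s i + s (i + 1))}

namespace IsSineSeq

variable {l : ℝ} {p : ℕ} {s : ℕ → ℝ}

lemma nonneg (hs : IsSineSeq l p s) {n : ℕ} (hn : n ≤ p) : 0 ≤ s n := by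
  cases n with
  | zero => exact hs.zero.ge
  | succ n => exact (hs.pos n hn).le

lemma neg_of_mem (hs : IsSineSeq l p s) {i : ℕ} (hi : i + 2 ≤ p) {x : ℝ}
    (hx : x ∈ cell s i) : x < 0 := by
  have h₀ := hs.nonneg (n := i) (by omega)
  have h₁ := hs.pos i (by omega)
  have h₂ := hs.pos (i + 1) hi
  by_contra! h
  have := mul_nonneg h (add_pos h₁ h₂).le
  linarith [hx.2]

lemma neg_half_le_of_mem (hs : IsSineSeq l p s) {i : ℕ} (hi : i + 2 ≤ p) {x : ℝ}
    (hx : x ∈ cell s i) : -(l / 2) ≤ x := by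
  have h₂ := hs.pos (i + 1) hi
  have h₃ := hs.le i hi
  have h₄ := hs.recurrence (i + 1)
  refine le_of_mul_le_mul_right ?_ h₂
  linarith [hx.1]

lemma G_mem (hs : IsSineSeq l p s) (hl : 0 < l) {i : ℕ} (hi : i + 3 ≤ p) {x : ℝ}
    (hx : x ∈ cell s i) : G l x ∈ cell s (i + 1) := by
  have h₁ := hs.pos i (by omega)
  have h₂ := hs.pos (i + 1) (by omega)
  have h₃ := hs.pos (i + 2) hi
  have r₁ := hs.recurrence i
  have r₂ := hs.recurrence (i + 1)
  have hd : 0 < l + x := by linarith [hs.neg_half_le_of_mem (by omega) hx]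
  obtain ⟨hx₁, hx₂⟩ := hx
  constructor
  · rw [G, div_mul_eq_mul_div, le_div_iff₀ hd]
    linarith
  · rw [G, div_mul_eq_mul_div, div_lt_iff₀ hd]
    linarith

lemma f_eq_of_mem (hs : IsSineSeq l p s) (hl : 0 < l) (hl₂ : l ≤ 2) {i : ℕ} (hi : i + 3 ≤ p)
    {x : ℝ} (hx : x ∈ cell s (i + 1)) : f l x = -1 / x - l := by
  have h₀ := hs.nonneg (n := i) (by omega)
  have h₁ := hs.pos i (by omega)
  have h₂ := hs.pos (i + 1) (by omega)
  have h₃ := hs.pos (i + 2) hi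
  have r₀ := hs.recurrence i
  have r₁ := hs.recurrence (i + 1)
  have hx₀ := hs.neg_of_mem (by omega) hx
  have hxl := hs.neg_half_le_of_mem (by omega) hx
  have key : 1 < (3 / 2) * (l * -x) := by
    have hd := add_pos h₂ h₃
    refine lt_of_mul_lt_mul_right ?_ hd.le
    have := mul_lt_mul_of_pos_left hx.2 hl
    linarith
  have := f_eq_of_branch 1 hl hx₀ (by push_cast; nlinarith) (by push_cast; linarith)
  simpa using this

lemma f_mem (hs : IsSineSeq l p s) (hl : 0 < l) (hl₂ : l ≤ 2) {i : ℕ} (hi : i + 3 ≤ p)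
    {x : ℝ} (hx : x ∈ cell s (i + 1)) : f l x ∈ cell s i := by
  have r₀ := hs.recurrence i
  have r₁ := hs.recurrence (i + 1)
  have hx₀ := hs.neg_of_mem (by omega) hx
  rw [hs.f_eq_of_mem hl hl₂ hi hx]
  have hinv : -1 / x = 1 / -x := by rw [div_neg, neg_div]
  have hx' : 0 < -x := by linarith
  obtain ⟨hx₁, hx₂⟩ := hx
  rw [hinv]
  constructor
  · have h : s (i + 2) * l - s (i + 1) ≤ 1 / -x * s (i + 2) := by
      have e : s (i + 2) * l - s (i + 1) = s (i + 3) := by linarith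
      rw [e, div_mul_eq_mul_div, le_div_iff₀ hx']
      linarith
    linarith
  · have h : 1 / -x * (s (i + 1) + s (i + 2)) <
        l * (s (i + 1) + s (i + 2)) - (s i + s (i + 1)) := by
      rw [div_mul_eq_mul_div, div_lt_iff₀ hx']
      have e : l * (s (i + 1) + s (i + 2)) - (s i + s (i + 1)) = s (i + 2) + s (i + 3) := by
        linarith
      rw [e]
      linarith
    linarith

lemma f_lt_iff (hs : IsSineSeq l p s) (hl : 0 < l) (hl₂ : l ≤ 2) {i : ℕ} (hi : i + 3 ≤ p)
    {x y : ℝ} (hx : x ∈ cell s (i + 1)) (hy : y ∈ cell s i) : f l x < y ↔ x < G l y := by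
  have hx₀ := hs.neg_of_mem (by omega) hx
  have hd : 0 < l + y := by linarith [hs.neg_half_le_of_mem (by omega) hy]
  rw [hs.f_eq_of_mem hl hl₂ hi hx, G, lt_div_iff₀ hd, sub_lt_iff_lt_add, div_lt_iff_of_neg hx₀,
    mul_comm, add_comm]

lemma iterate_f_mem (hs : IsSineSeq l p s) (hl : 0 < l) (hl₂ : l ≤ 2) {n : ℕ} (hn : n + 2 ≤ p)
    {x : ℝ} (hx : x ∈ cell s n) : (f l)^[n] x ∈ cell s 0 := by
  induction n generalizing x with
  | zero => exact hx
  | succ n ih => exact ih (by omega) (hs.f_mem hl hl₂ hn hx)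

lemma iterate_G_mem (hs : IsSineSeq l p s) (hl : 0 < l) {n : ℕ} (hn : n + 2 ≤ p)
    {y : ℝ} (hy : y ∈ cell s 0) : (G l)^[n] y ∈ cell s n := by
  induction n with
  | zero => exact hy
  | succ n ih =>
    rw [Function.iterate_succ_apply']
    exact hs.G_mem hl hn (ih (by omega))

lemma iterate_f_lt_iff (hs : IsSineSeq l p s) (hl : 0 < l) (hl₂ : l ≤ 2) {n : ℕ}
    (hn : n + 2 ≤ p) {x y : ℝ} (hx : x ∈ cell s n) (hy : y ∈ cell s 0) :
    (f l)^[n] x < y ↔ x < (G l)^[n] y := by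
  induction n generalizing x with
  | zero => rfl
  | succ n ih =>
    rw [Function.iterate_succ_apply, Function.iterate_succ_apply',
      ih (by omega) (hs.f_mem hl hl₂ hn hx),
      hs.f_lt_iff hl hl₂ hn hx (hs.iterate_G_mem hl (by omega) hy)]

lemma cell_zero (hs : IsSineSeq l p s) (hl : 0 < l) (hp : 2 ≤ p) :
    cell s 0 = Set.Ico (-1 / l) (-1 / (l + 1)) := by
  have h₁ : 0 < s 1 := hs.pos 0 (by omega)
  have r : s 2 = l * s 1 := by simpa [hs.zero] using hs.recurrence 0
  ext x
  simp only [cell, Set.mem_ofPred_eq, Set.mem_Ico, zero_add, hs.zero, r]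
  have e₁ : x * (l * s 1) = x * l * s 1 := by ring
  have e₂ : x * (s 1 + l * s 1) = x * (l + 1) * s 1 := by ring
  rw [div_le_iff₀ hl, lt_div_iff₀ (by linarith), ← mul_le_mul_iff_left₀ h₁ (b := -1),
    ← mul_lt_mul_iff_left₀ h₁ (b := x * (l + 1)), e₁, e₂, neg_one_mul]

lemma cell_top {m : ℕ} (hs : IsSineSeq l (m + 2) s) :
    cell s m = Set.Ico (-(l / 2)) (1 - l) := by
  have h₁ := hs.pos m (by omega)
  have h₂ := hs.pos (m + 1) (by omega)
  have r₀ := hs.recurrence m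
  have r₁ := hs.recurrence (m + 1)
  have r₂ := hs.symm m rfl
  ext x
  simp only [cell, Set.mem_ofPred_eq, Set.mem_Ico]
  rw [← mul_le_mul_iff_left₀ h₂ (b := -(l / 2)),
    ← mul_lt_mul_iff_left₀ (add_pos h₁ h₂) (c := 1 - l)]
  have e₁ : -(l / 2) * s (m + 2) = -s (m + 1) := by linarith
  have e₂ : (1 - l) * (s (m + 1) + s (m + 2)) = -(s m + s (m + 1)) := by linarith
  rw [show m + 1 + 1 = m + 2 from rfl, e₁, e₂]

end IsSineSeq

section Return

variable {l : ℝ} {m : ℕ} {s : ℕ → ℝ} {t y : ℝ}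

lemma f_eq_of_mem_Ico (hl : 1 < l) (ht : t ∈ Set.Ico (-2 / (3 * l)) (-1 / (l + 1))) :
    t < 0 ∧ f l t = -1 / t - 2 * l := by
  obtain ⟨h₁, h₂⟩ := ht
  rw [div_le_iff₀ (by linarith)] at h₁
  rw [lt_div_iff₀ (by linarith)] at h₂
  have ht : t < 0 := by nlinarith
  refine ⟨ht, ?_⟩
  rw [f_eq_of_branch 2 (by linarith) ht (by push_cast; linarith) (by push_cast; nlinarith)]
  push_cast
  ring

lemma f_mem_Ico (hl : 1 < l) (ht : t ∈ Set.Ico (-2 / (3 * l)) (-1 / (l + 1))) :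
    f l t ∈ Set.Ico (-(l / 2)) (1 - l) := by
  obtain ⟨ht₀, hf⟩ := f_eq_of_mem_Ico hl ht
  rw [hf]
  obtain ⟨h₁, h₂⟩ := ht
  rw [div_le_iff₀ (by linarith)] at h₁
  rw [lt_div_iff₀ (by linarith)] at h₂
  constructor
  · rw [le_sub_iff_add_le, le_div_iff_of_neg ht₀]
    linarith
  · rw [sub_lt_iff_lt_add, div_lt_iff_of_neg ht₀]
    linarith

lemma f_lt_iff_of_mem_Ico (hl : 1 < l) (ht : t ∈ Set.Ico (-2 / (3 * l)) (-1 / (l + 1)))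
    (hy : -(l / 2) ≤ y) : f l t < y ↔ t < -1 / (2 * l + y) := by
  obtain ⟨ht₀, hf⟩ := f_eq_of_mem_Ico hl ht
  rw [hf, lt_div_iff₀ (by linarith), sub_lt_iff_lt_add, div_lt_iff_of_neg ht₀, mul_comm, add_comm]

lemma neg_one_div_two_mul_add_mem (hl : 1 < l) (hy : y ∈ Set.Ico (-(l / 2)) (1 - l)) :
    -1 / (2 * l + y) ∈ Set.Ico (-2 / (3 * l)) (-1 / (l + 1)) := by
  obtain ⟨h₁, h₂⟩ := hy
  constructor
  · rw [div_le_div_iff₀ (by linarith) (by linarith)]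
    linarith
  · rw [div_lt_div_iff₀ (by linarith) (by linarith)]
    linarith

lemma Ico_subset_cell_zero (hs : IsSineSeq l (m + 2) s) (hl : 0 < l) :
    Set.Ico (-2 / (3 * l)) (-1 / (l + 1)) ⊆ cell s 0 := by
  rw [hs.cell_zero hl (by omega)]
  apply Set.Ico_subset_Ico_left
  rw [div_le_div_iff₀ hl (by linarith)]
  linarith

lemma tauE_mem (hs : IsSineSeq l (m + 2) s) (hl : 1 < l) (hl₂ : l < 2) (k : ℕ) :
    tauE l (m + 2) k ∈ Set.Ico (-2 / (3 * l)) (-1 / (l + 1)) := by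
  induction k with
  | zero =>
    refine ⟨le_rfl, ?_⟩
    rw [tauE, div_lt_div_iff₀ (by linarith) (by linarith)]
    linarith
  | succ k ih =>
    apply neg_one_div_two_mul_add_mem hl
    rw [← hs.cell_top]
    exact hs.iterate_G_mem (by linarith) le_rfl (Ico_subset_cell_zero hs (by linarith) ih)

lemma iterate_f_mem_cell_zero (hs : IsSineSeq l (m + 2) s) (hl : 1 < l) (hl₂ : l < 2)
    (ht : t ∈ Set.Ico (-2 / (3 * l)) (-1 / (l + 1))) : (f l)^[m + 1] t ∈ cell s 0 := by
  rw [Function.iterate_succ_apply]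
  refine hs.iterate_f_mem (by linarith) hl₂.le le_rfl ?_
  rw [hs.cell_top]
  exact f_mem_Ico hl ht

lemma iterate_f_lt_tauE_iff (hs : IsSineSeq l (m + 2) s) (hl : 1 < l) (hl₂ : l < 2)
    (ht : t ∈ Set.Ico (-2 / (3 * l)) (-1 / (l + 1))) (k : ℕ) :
    (f l)^[m + 1] t < tauE l (m + 2) k ↔ t < tauE l (m + 2) (k + 1) := by
  have hl₀ : 0 < l := by linarith
  have hft : f l t ∈ cell s m := by
    rw [hs.cell_top]
    exact f_mem_Ico hl ht
  have hτ := Ico_subset_cell_zero hs hl₀ (tauE_mem hs hl hl₂ k)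
  rw [Function.iterate_succ_apply, hs.iterate_f_lt_iff hl₀ hl₂.le le_rfl hft hτ,
    f_lt_iff_of_mem_Ico hl ht
      (hs.neg_half_le_of_mem le_rfl (hs.iterate_G_mem hl₀ le_rfl hτ))]
  rfl

lemma tauE_le_and_lt_iff (hs : IsSineSeq l (m + 2) s) (hl : 1 < l) (hl₂ : l < 2)
    (hlsq : 2 ≤ l ^ 2) (k : ℕ) (ht : t ∈ Set.Ico (-2 / (3 * l)) (-1 / (l + 1))) :
    (tauE l (m + 2) k ≤ t ∧ t < tauE l (m + 2) (k + 1)) ↔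
      ((∀ j ≤ k, (f l)^[j * (m + 1)] t ∈ Set.Ico (-2 / (3 * l)) (-1 / (l + 1))) ∧
        (f l)^[(k + 1) * (m + 1)] t ∈ Set.Ico (-(l / 2)) (-2 / (3 * l))) := by
  have hK := iterate_f_mem_cell_zero hs hl hl₂ ht
  rw [hs.cell_zero (by linarith) (by omega)] at hK
  have hlt := iterate_f_lt_tauE_iff hs hl hl₂ ht
  induction k generalizing t with
  | zero =>
    have hlow : -(l / 2) ≤ (f l)^[m + 1] t := by
      refine le_trans ?_ hK.1
      rw [le_div_iff₀ (by linarith)]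
      linarith
    have h₀ := hlt 0
    simp only [tauE.eq_1] at h₀
    simp only [Nat.le_zero, forall_eq, zero_mul, zero_add, one_mul, Function.iterate_zero, id_eq,
      ← h₀, tauE.eq_1, Set.mem_Ico, hlow, true_and, ht.1, ht.2, and_self]
  | succ k ih =>
    have hshift : ∀ j, (f l)^[(j + 1) * (m + 1)] t = (f l)^[j * (m + 1)] ((f l)^[m + 1] t) := by
      intro j
      rw [add_mul, one_mul, Function.iterate_add_apply]
    rw [← hlt (k + 1), ← not_lt, ← hlt k, not_lt]
    by_cases hmem : (f l)^[m + 1] t ∈ Set.Ico (-2 / (3 * l)) (-1 / (l + 1))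
    · have hK' := iterate_f_mem_cell_zero hs hl hl₂ hmem
      rw [hs.cell_zero (by linarith) (by omega)] at hK'
      rw [hshift (k + 1)]
      refine (ih hmem hK' (iterate_f_lt_tauE_iff hs hl hl₂ hmem)).trans (and_congr_left fun _ => ⟨fun h j hj => ?_, fun h j hj => ?_⟩)
      · cases j with
        | zero => simpa using ht
        | succ j =>
          rw [hshift]
          exact h j (by omega)
      · rw [← hshift]
        exact h (j + 1) (by omega)
    · constructor
      · rintro ⟨h, -⟩
        exact absurd ⟨(tauE_mem hs hl hl₂ k).1.trans h, hK.2⟩ hmem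
      · rintro ⟨h, -⟩
        exact absurd (by simpa using h 1 (by omega)) hmem

end Return

/-- a point of `A` is flushed after exactly `k` rounds iff `τ_{k-1} ≤ t < τ_k`. -/
theorem flushing_iff_even (q p : ℕ) (hp : 2 ≤ p) (hq : q = 2 * p)
    (t : ℝ) (ht : t ∈ Set.Ico (-2 / (3 * lam q)) (-1 / (lam q + 1)))
    (k : ℕ) (hk : 1 ≤ k) :
    (tauE (lam q) p (k - 1) ≤ t ∧ t < tauE (lam q) p k) ↔
      ((∀ j : ℕ, j ≤ k - 1 →
          (f (lam q))^[j * (p - 1)] t ∈ Set.Ico (-2 / (3 * lam q)) (-1 / (lam q + 1))) ∧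
        (f (lam q))^[k * (p - 1)] t ∈ Set.Ico (-(lam q / 2)) (-2 / (3 * lam q))) := by
  subst hq
  obtain ⟨m, rfl⟩ := Nat.exists_eq_add_of_le' hp
  obtain ⟨k, rfl⟩ := Nat.exists_eq_add_of_le' hk
  have hsq := two_le_lam_sq hp
  have hl : 1 < lam (2 * (m + 2)) := by nlinarith [lam_pos hp]
  exact tauE_le_and_lt_iff (isSineSeq_sin hp) hl (lam_lt_two hp) hsq k ht
end RosenTong
end
end
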